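/- arXiv:2210.06131 — 6 statements merged into one kernel-verified Lean document; each statement's English description precedes it below -/
import Mathlib

section
/- Let Φ : ℝ → ℝ be continuous and monotone increasing (Φ(x) ≤ Φ(y) whenever x ≤ y), and let v₋ < v₊ satisfy Φ(v₋) > v₋ and Φ(v₊) < v₊. Assume that for every v₀ ∈ ℝ there exists k ∈ ℕ with Φᵏ(v₀) ∈ [v₋, v₊]. Then the limits α := lim_{i→∞} Φⁱ(v₋) and β := lim_{i→∞} Φⁱ(v₊) exist and satisfy v₋ < α ≤ β < v₊; the set K := ⋂_{i∈ℕ} Φⁱ([v₋, v₊]) equals the interval [α, β]; Φ(α) = α and Φ(β) = β; and for every v₀ ∈ ℝ the sequence (Φⁱ(v₀))_{i∈ℕ} converges to some v* ∈ [α, β] with Φ(v*) = v*. -/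
open Set Filter Topology

/-- Inside an invariant compact interval, every orbit of a continuous monotone map converges to a
fixed point. -/
theorem Monotone.exists_fixedPoint_tendsto_iterate {f : ℝ → ℝ} (hmono : Monotone f)
    (hcont : Continuous f) {a b : ℝ} (hmaps : MapsTo f (Icc a b) (Icc a b)) {x : ℝ}
    (hx : x ∈ Icc a b) :
    ∃ y, f y = y ∧ Tendsto (fun i : ℕ => f^[i] x) atTop (𝓝 y) := by
  have hmem (i : ℕ) : f^[i] x ∈ Icc a b := hmaps.iterate i hx
  have hlim : ∃ y, Tendsto (fun i : ℕ => f^[i] x) atTop (𝓝 y) := by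
    rcases le_total x (f x) with h | h
    · exact ⟨_, tendsto_atTop_ciSup (hmono.monotone_iterate_of_le_map h)
        ⟨b, by rintro _ ⟨i, rfl⟩; exact (hmem i).2⟩⟩
    · exact ⟨_, tendsto_atTop_ciInf (hmono.antitone_iterate_of_map_le h)
        ⟨a, by rintro _ ⟨i, rfl⟩; exact (hmem i).1⟩⟩
  obtain ⟨y, hy⟩ := hlim
  exact ⟨y, isFixedPt_of_tendsto_iterate hy hcont.continuousAt, hy⟩

/-- A continuous monotone map sends a compact interval onto the interval between the images of the
endpoints. -/
theorem Monotone.image_Icc_eq_of_continuous {f : ℝ → ℝ} (hmono : Monotone f)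
    (hcont : Continuous f) {a b : ℝ} (hab : a ≤ b) :
    f '' Icc a b = Icc (f a) (f b) :=
  (hmono.mapsTo_Icc.image_subset).antisymm (intermediate_value_Icc hab hcont.continuousOn)

/-- Asymptotics of the discrete dynamics induced by a continuous
monotone Poincaré map `Φ` with `Φ v₋ > v₋`, `Φ v₊ < v₊`, every orbit entering `[v₋, v₊]`. -/
theorem poincare_map_attractor (Φ : ℝ → ℝ) (hcont : Continuous Φ) (hmono : Monotone Φ)
    (vm vp : ℝ) (hlt : vm < vp) (hvm : vm < Φ vm) (hvp : Φ vp < vp)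
    (habs : ∀ v₀ : ℝ, ∃ k : ℕ, Φ^[k] v₀ ∈ Set.Icc vm vp) :
    ∃ α β : ℝ,
      Tendsto (fun i : ℕ => Φ^[i] vm) atTop (𝓝 α) ∧
      Tendsto (fun i : ℕ => Φ^[i] vp) atTop (𝓝 β) ∧
      vm < α ∧ α ≤ β ∧ β < vp ∧
      (⋂ i : ℕ, Φ^[i] '' Set.Icc vm vp) = Set.Icc α β ∧
      Φ α = α ∧ Φ β = β ∧
      ∀ v₀ : ℝ, ∃ vstar ∈ Set.Icc α β, Φ vstar = vstar ∧
        Tendsto (fun i : ℕ => Φ^[i] v₀) atTop (𝓝 vstar) := by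
  have hmaps : MapsTo Φ (Icc vm vp) (Icc vm vp) := fun x hx =>
    ⟨hvm.le.trans (hmono hx.1), (hmono hx.2).trans hvp.le⟩
  obtain ⟨α, hα, hαlim⟩ :=
    hmono.exists_fixedPoint_tendsto_iterate hcont hmaps (left_mem_Icc.2 hlt.le)
  obtain ⟨β, hβ, hβlim⟩ :=
    hmono.exists_fixedPoint_tendsto_iterate hcont hmaps (right_mem_Icc.2 hlt.le)
  have hleα (i : ℕ) : Φ^[i] vm ≤ α :=
    (hmono.monotone_iterate_of_le_map hvm.le).ge_of_tendsto hαlim i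
  have hβle (i : ℕ) : β ≤ Φ^[i] vp :=
    (hmono.antitone_iterate_of_map_le hvp.le).le_of_tendsto hβlim i
  refine ⟨α, β, hαlim, hβlim, hvm.trans_le (hleα 1),
    le_of_tendsto_of_tendsto' hαlim hβlim fun i => hmono.iterate i hlt.le,
    (hβle 1).trans_lt hvp, ?_, hα, hβ, fun v₀ => ?_⟩
  · simp_rw [fun i => (hmono.iterate i).image_Icc_eq_of_continuous (hcont.iterate i) hlt.le]
    ext x
    simp only [mem_iInter, mem_Icc]
    exact ⟨fun h => ⟨le_of_tendsto' hαlim fun i => (h i).1, ge_of_tendsto' hβlim fun i => (h i).2⟩,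
      fun h i => ⟨(hleα i).trans h.1, h.2.trans (hβle i)⟩⟩
  · obtain ⟨k, hk⟩ := habs v₀
    obtain ⟨y, hy, hylim⟩ := hmono.exists_fixedPoint_tendsto_iterate hcont hmaps hk
    refine ⟨y, ⟨le_of_tendsto_of_tendsto' hαlim hylim fun i => hmono.iterate i hk.1,
      le_of_tendsto_of_tendsto' hylim hβlim fun i => hmono.iterate i hk.2⟩, hy, ?_⟩
    rw [← tendsto_add_atTop_iff_nat k]
    simpa only [Function.iterate_add_apply] using hylim
end

section
/- Suppose G : ℝ × ℝ → P(ℝ) satisfies the structural assumptions (S1) and (S2). Then every solution v of the differential inclusion v̇ ∈ G(t,v) on an interval [t₀, ∞) with v(t₀) = v₀ satisfies min{v₀ − ‖ℓ_d^−‖_{L¹(0,T)}, v₋} ≤ v(t) ≤ max{v₀ + ‖ℓ_d^+‖_{L¹(0,T)}, v₊} for every t ≥ t₀. -/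
open MeasureTheory Set Filter Topology

/-- A set-valued map `F : ℝ → P(ℝ)` is monotone increasing. -/
def SVMonoInc (F : ℝ → Set ℝ) : Prop :=
  ∀ ⦃u₁ u₂ y₁ y₂ : ℝ⦄, y₁ ∈ F u₁ → y₂ ∈ F u₂ → u₁ ≠ u₂ → 0 ≤ (y₂ - y₁) * (u₂ - u₁)

/-- A set-valued map `F : ℝ → P(ℝ)` is maximal monotone increasing:
it is monotone increasing and its graph is maximal among graphs of
monotone increasing set-valued maps. -/
def SVMaxMonoInc (F : ℝ → Set ℝ) : Prop :=
  SVMonoInc F ∧ ∀ F' : ℝ → Set ℝ, SVMonoInc F' → (∀ u, F u ⊆ F' u) → ∀ u, F' u ⊆ F u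

/-- Structural assumption (S1): `G(t,u) = -A(t,u) + p(t,u)` where `A` is nonempty-valued,
`T`-periodic in `t`, measurable in `t`, locally bounded by a measurable function and
maximal monotone increasing in `u`; and `p` is a single-valued Carathéodory function,
`T`-periodic in `t` and locally Lipschitz in `u` uniformly in `t`. -/
def SatS1 (T : ℝ) (G : ℝ → ℝ → Set ℝ) : Prop :=
  ∃ (A : ℝ → ℝ → Set ℝ) (p : ℝ → ℝ → ℝ),
    (∀ t u, G t u = {x | ∃ y ∈ A t u, x = -y + p t u}) ∧
    (∀ t u, (A t u).Nonempty) ∧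
    (∀ u, Function.Periodic (fun t => A t u) T) ∧
    (∀ u, MeasurableSet {q : ℝ × ℝ | q.2 ∈ A q.1 u}) ∧
    (∀ r : ℝ, 0 < r → ∃ m : ℝ → ℝ, Measurable m ∧
      ∀ t u y, |u| ≤ r → y ∈ A t u → |y| ≤ m t) ∧
    (∀ t, SVMaxMonoInc (A t)) ∧
    (∀ u, Measurable fun t => p t u) ∧
    (∀ t, Continuous fun u => p t u) ∧
    (∀ u, Function.Periodic (fun t => p t u) T) ∧
    (∀ r : ℝ, 0 < r → ∃ L : ℝ, ∀ t u₁ u₂, |u₁| ≤ r → |u₂| ≤ r →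
      |p t u₁ - p t u₂| ≤ L * |u₁ - u₂|)

/-- Structural assumption (S2), with explicit data `R`, `ℓm = ℓ_d^-`, `ℓp = ℓ_d^+`. -/
def S2Data (T : ℝ) (G : ℝ → ℝ → Set ℝ) (R : ℝ) (ℓm ℓp : ℝ → ℝ) : Prop :=
  0 < R ∧ Measurable ℓm ∧ Measurable ℓp ∧
    Function.Periodic ℓm T ∧ Function.Periodic ℓp T ∧
    (∫ s in (0:ℝ)..T, ℓm s) < 0 ∧ (∫ s in (0:ℝ)..T, ℓp s) < 0 ∧
    (∀ᵐ t ∂(volume : Measure ℝ), ∀ u ≤ -R, ∀ y ∈ G t u, -ℓm t ≤ y) ∧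
    (∀ᵐ t ∂(volume : Measure ℝ), ∀ u, R ≤ u → ∀ y ∈ G t u, y ≤ ℓp t)

/-- Structural assumption (S2). -/
def SatS2 (T : ℝ) (G : ℝ → ℝ → Set ℝ) : Prop :=
  ∃ R ℓm ℓp, S2Data T G R ℓm ℓp

/-- `v` is a solution of the differential inclusion `v̇ ∈ G(t,v)` on the interval `I`:
`v` is locally absolutely continuous on `I` (primitive of a locally integrable `g`)
and its a.e. derivative `g` satisfies `g t ∈ G t (v t)` for a.e. `t ∈ I`. -/
def IsSolOn (G : ℝ → ℝ → Set ℝ) (v : ℝ → ℝ) (I : Set ℝ) : Prop :=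
  ∃ g : ℝ → ℝ,
    (∀ a ∈ I, ∀ b ∈ I, a ≤ b →
      IntervalIntegrable g volume a b ∧ v b - v a = ∫ s in a..b, g s) ∧
    (∀ᵐ t ∂(volume : Measure ℝ), t ∈ I → g t ∈ G t (v t))

/-- The integral of a periodic function of nonpositive mean over any interval is at most the
`L¹` norm of the function over one period. -/
theorem Function.Periodic.intervalIntegral_le_integral_abs {T : ℝ} (hT : 0 < T) {ℓ : ℝ → ℝ}
    (hper : Function.Periodic ℓ T) (hint : IntervalIntegrable ℓ volume 0 T)
    (hneg : ∫ s in (0:ℝ)..T, ℓ s ≤ 0) {a b : ℝ} (hab : a ≤ b) :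
    ∫ s in a..b, ℓ s ≤ ∫ s in (0:ℝ)..T, |ℓ s| := by
  have hI : ∀ x y, IntervalIntegrable ℓ volume x y := fun x y =>
    hper.intervalIntegrable₀ hT.ne' hint x y
  set n : ℕ := ⌊(b - a) / T⌋₊ with hn
  have h1 : (n : ℝ) * T ≤ b - a :=
    (le_div_iff₀ hT).1 (Nat.floor_le (div_nonneg (sub_nonneg.2 hab) hT.le))
  have h2 : b - a < (n + 1 : ℝ) * T := (div_lt_iff₀ hT).1 (Nat.lt_floor_add_one _)
  have habsper : Function.Periodic (fun s => |ℓ s|) T := fun s => by simp only [hper s]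
  have hfull : ∫ s in a..(a + n * T), ℓ s ≤ 0 := by
    have h := hper.intervalIntegral_add_zsmul_eq (n : ℤ) a (fun x y => hI x y)
    simp only [zsmul_eq_mul, Int.cast_natCast] at h
    rw [h, hper.intervalIntegral_add_eq a 0, zero_add]
    exact mul_nonpos_of_nonneg_of_nonpos (Nat.cast_nonneg n) hneg
  have hrem : ∫ s in (a + n * T)..b, ℓ s ≤ ∫ s in (0:ℝ)..T, |ℓ s| := calc
    ∫ s in (a + n * T)..b, ℓ s ≤ ∫ s in (a + n * T)..b, |ℓ s| :=
      intervalIntegral.integral_mono_on (by linarith) (hI _ _) (hI _ _).abs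
        fun s _ => le_abs_self _
    _ ≤ ∫ s in (a + n * T)..(a + n * T + T), |ℓ s| :=
      intervalIntegral.integral_mono_interval le_rfl (by linarith) (by linarith)
        (Eventually.of_forall fun s => abs_nonneg _) (hI _ _).abs
    _ = ∫ s in (0:ℝ)..T, |ℓ s| := by
      rw [habsper.intervalIntegral_add_eq (a + n * T) 0, zero_add]
  rw [← intervalIntegral.integral_add_adjacent_intervals (hI a (a + n * T)) (hI _ b)]
  linarith

/-- A primitive `v` of `g` on `[t₀, ∞)`, whose derivative is dominated above the level `R` by a
periodic function `ℓ` of negative mean, exceeds `max (v t₀) R` by at most the `L¹` norm of `ℓ`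
over one period. -/
theorem le_max_add_integral_abs_of_deriv_le_periodic {T : ℝ} (hT : 0 < T) {ℓ : ℝ → ℝ}
    (hper : Function.Periodic ℓ T) (hneg : ∫ s in (0:ℝ)..T, ℓ s < 0) {R t₀ : ℝ} {v g : ℝ → ℝ}
    (hv : ∀ a ∈ Ici t₀, ∀ b ∈ Ici t₀, a ≤ b →
      IntervalIntegrable g volume a b ∧ v b - v a = ∫ s in a..b, g s)
    (hg : ∀ᵐ t ∂(volume : Measure ℝ), t ∈ Ici t₀ → R ≤ v t → g t ≤ ℓ t) {t : ℝ} (ht : t₀ ≤ t) :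
    v t ≤ max (v t₀) R + ∫ s in (0:ℝ)..T, |ℓ s| := by
  have hint : IntervalIntegrable ℓ volume 0 T := by
    by_contra h
    exact hneg.ne (intervalIntegral.integral_undef h)
  have hcont : ContinuousOn v (Icc t₀ t) := by
    have h := (intervalIntegral.continuousOn_primitive_interval'
      (hv t₀ self_mem_Ici t ht ht).1 left_mem_uIcc).const_add (v t₀)
    rw [uIcc_of_le ht] at h
    refine h.congr fun x hx => ?_
    linarith [(hv t₀ self_mem_Ici x hx.1 hx.1).2]
  obtain ⟨s, ⟨hs, hsM⟩, hmax⟩ : ∃ s, IsGreatest {s ∈ Icc t₀ t | v s ≤ max (v t₀) R} s := by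
    refine IsCompact.exists_isGreatest ?_ ⟨t₀, left_mem_Icc.2 ht, le_max_left _ _⟩
    exact isCompact_Icc.of_isClosed_subset
      (hcont.preimage_isClosed_of_isClosed isClosed_Icc isClosed_Iic) (sep_subset _ _)
  have hle : v t - v s ≤ ∫ x in s..t, ℓ x := by
    obtain ⟨hgi, heq⟩ := hv s hs.1 t ht hs.2
    rw [heq]
    refine intervalIntegral.integral_mono_ae_restrict hs.2 hgi
      (hper.intervalIntegrable₀ hT.ne' hint s t) ?_
    rw [← restrict_Ioc_eq_restrict_Icc]
    filter_upwards [ae_restrict_of_ae hg, ae_restrict_mem measurableSet_Ioc] with x hx hxs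
    have hx₀ : t₀ ≤ x := hs.1.trans hxs.1.le
    refine hx hx₀ ?_
    by_contra! hlt
    exact hxs.1.not_ge (hmax ⟨⟨hx₀, hxs.2⟩, hlt.le.trans (le_max_right _ _)⟩)
  linarith [hper.intervalIntegral_le_integral_abs hT hint hneg.le hs.2]

/-- Under (S1) and (S2), every solution of `v̇ ∈ G(t,v)` on `[t₀,∞)`
with `v t₀ = v₀` stays between `min{v₀ - ‖ℓ_d^-‖_{L¹(0,T)}, v₋}` and
`max{v₀ + ‖ℓ_d^+‖_{L¹(0,T)}, v₊}` for all `t ≥ t₀`, where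
`v₋ = -R - ‖ℓ_d^-‖_{L¹(0,T)}` and `v₊ = R + ‖ℓ_d^+‖_{L¹(0,T)}`. -/
theorem solutions_bounded (T : ℝ) (hT : 0 < T) (G : ℝ → ℝ → Set ℝ)
    (hS1 : SatS1 T G) (R : ℝ) (ℓm ℓp : ℝ → ℝ) (hS2 : S2Data T G R ℓm ℓp)
    (t₀ v₀ : ℝ) (v : ℝ → ℝ) (hv : IsSolOn G v (Set.Ici t₀)) (hv₀ : v t₀ = v₀) :
    ∀ t, t₀ ≤ t →
      min (v₀ - ∫ s in (0:ℝ)..T, |ℓm s|) (-R - ∫ s in (0:ℝ)..T, |ℓm s|) ≤ v t ∧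
      v t ≤ max (v₀ + ∫ s in (0:ℝ)..T, |ℓp s|) (R + ∫ s in (0:ℝ)..T, |ℓp s|) := by
  obtain ⟨-, -, -, hmper, hpper, hmneg, hpneg, hm, hp⟩ := hS2
  obtain ⟨g, hvg, hgG⟩ := hv
  subst hv₀
  intro t ht
  constructor
  · have h := le_max_add_integral_abs_of_deriv_le_periodic hT hmper hmneg (R := R)
      (v := fun x => -v x) (g := fun x => -g x)
      (fun a ha b hb hab => ⟨(hvg a ha b hb hab).1.neg, by
        rw [intervalIntegral.integral_neg, ← (hvg a ha b hb hab).2]; ring⟩)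
      (by
        filter_upwards [hm, hgG] with x hx hxG hx₀ hR
        linarith [hx (v x) (by linarith) (g x) (hxG hx₀)]) ht
    rw [min_sub_sub_right]
    rw [← neg_neg R, max_neg_neg] at h
    linarith
  · rw [max_add_add_right]
    refine le_max_add_integral_abs_of_deriv_le_periodic hT hpper hpneg hvg ?_ ht
    filter_upwards [hp, hgG] with x hx hxG hx₀ hR
    exact hx (v x) hR (g x) (hxG hx₀)
end

section
/- Suppose G : ℝ × ℝ → P(ℝ) satisfies the structural assumptions (S1) and (S2). Then for every solution v of the differential inclusion v̇ ∈ G(t,v) on an interval [t₀, ∞) there exists a T-periodic solution v* of the same inclusion, with v*(0) ∈ [v₋, v₊], such that lim_{t→+∞} (v(t) − v*(t)) = 0. -/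
open MeasureTheory Set Filter Topology

lemma integral_mono_of_ae_Ioc {f g : ℝ → ℝ} {a b : ℝ} (hab : a ≤ b)
    (hf : IntervalIntegrable f volume a b) (hg : IntervalIntegrable g volume a b)
    (h : ∀ᵐ t, t ∈ Ioc a b → f t ≤ g t) : (∫ t in a..b, f t) ≤ ∫ t in a..b, g t := by
  rw [intervalIntegral.integral_of_le hab, intervalIntegral.integral_of_le hab]
  exact setIntegral_mono_ae_restrict hf.1 hg.1 ((ae_restrict_iff' measurableSet_Ioc).2 h)

lemma exists_last_le {u w : ℝ → ℝ} {a b : ℝ} (hu : ContinuousOn u (Icc a b))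
    (hw : ContinuousOn w (Icc a b)) (h : ∃ x ∈ Icc a b, u x ≤ w x) :
    ∃ c ∈ Icc a b, u c ≤ w c ∧ ∀ t ∈ Ioc c b, w t < u t := by
  obtain ⟨x, hx, hxle⟩ := h
  obtain ⟨c, ⟨hc, hcle⟩, hcmax⟩ :=
    (isCompact_Icc.of_isClosed_subset (isClosed_Icc.isClosed_le hu hw)
      (fun x hx => hx.1)).exists_isGreatest ⟨x, hx, hxle⟩
  refine ⟨c, hc, hcle, fun t ht => ?_⟩
  by_contra! hle
  exact ht.1.not_ge (hcmax ⟨⟨hc.1.trans ht.1.le, ht.2⟩, hle⟩)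

/-- A nonnegative continuous function dominated by a multiple of its own primitive vanishes. -/
lemma eq_zero_of_le_mul_integral {f : ℝ → ℝ} {K a b : ℝ} (hf : Continuous f)
    (h0 : ∀ x ∈ Icc a b, 0 ≤ f x) (hK : ∀ x ∈ Icc a b, f x ≤ K * ∫ t in a..x, f t) :
    ∀ x ∈ Icc a b, f x = 0 := by
  have hd : ∀ x, HasDerivAt (fun y => ∫ t in a..y, f t) (f x) x := fun x =>
    (hf.integral_hasStrictDerivAt a x).hasDerivAt
  have hnn : ∀ x ∈ Icc a b, 0 ≤ ∫ t in a..x, f t := fun x hx =>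
    intervalIntegral.integral_nonneg hx.1 fun t ht => h0 t ⟨ht.1, ht.2.trans hx.2⟩
  have hz := eq_zero_of_abs_deriv_le_mul_abs_self_of_eq_zero_right (K := K) (a := a) (b := b)
    (f := fun y => ∫ t in a..y, f t) (f' := f)
    (fun x _ => (hd x).continuousAt.continuousWithinAt) (fun x _ => (hd x).hasDerivWithinAt)
    (by simp) (fun x hx => by
      have hx' : x ∈ Icc a b := ⟨hx.1, hx.2.le⟩
      rw [Real.norm_of_nonneg (h0 x hx'), Real.norm_of_nonneg (hnn x hx')]
      exact hK x hx')
  intro x hx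
  have h1 := hK x hx
  rw [hz x hx, mul_zero] at h1
  exact le_antisymm h1 (h0 x hx)

/-- `v` is a primitive of the locally integrable function `g` on `[t₀, ∞)`. -/
def IsPrimitiveFrom (v g : ℝ → ℝ) (t₀ : ℝ) : Prop :=
  ∀ a ∈ Ici t₀, ∀ b ∈ Ici t₀, a ≤ b →
    IntervalIntegrable g volume a b ∧ v b - v a = ∫ s in a..b, g s

namespace IsPrimitiveFrom

variable {u w g h : ℝ → ℝ} {t₀ t₁ : ℝ}

lemma mono (hu : IsPrimitiveFrom u g t₀) (ht : t₀ ≤ t₁) : IsPrimitiveFrom u g t₁ :=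
  fun a ha b hb hab => hu a (ht.trans ha) b (ht.trans hb) hab

lemma neg (hu : IsPrimitiveFrom u g t₀) :
    IsPrimitiveFrom (fun t => -u t) (fun t => -g t) t₀ := by
  intro a ha b hb hab
  obtain ⟨h1, h2⟩ := hu a ha b hb hab
  refine ⟨h1.neg, ?_⟩
  rw [intervalIntegral.integral_neg, ← h2]
  ring

lemma comp_add (hu : IsPrimitiveFrom u g t₀) {c : ℝ} (hc : 0 ≤ c) :
    IsPrimitiveFrom (fun t => u (t + c)) (fun t => g (t + c)) t₀ := by
  intro a ha b hb hab
  simp only [mem_Ici] at ha hb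
  obtain ⟨h1, h2⟩ := hu (a + c) (by simp; linarith) (b + c) (by simp; linarith) (by linarith)
  refine ⟨?_, ?_⟩
  · simpa using h1.comp_add_right c
  · rw [intervalIntegral.integral_comp_add_right]
    exact h2

lemma continuousOn (hu : IsPrimitiveFrom u g t₀) {a b : ℝ} (ha : t₀ ≤ a) (hab : a ≤ b) :
    ContinuousOn u (Icc a b) := by
  have h1 := (hu a ha b (ha.trans hab) hab).1
  have h2 := intervalIntegral.continuousOn_primitive_interval' h1 left_mem_uIcc
  rw [uIcc_of_le hab] at h2
  refine (h2.const_add (u a)).congr fun x hx => ?_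
  have := (hu a ha x (ha.trans hx.1) hx.1).2
  simp only
  linarith

/-- Comparison principle for primitives whose derivatives satisfy a one-sided Lipschitz
estimate. -/
lemma comparison (hu : IsPrimitiveFrom u g t₀) (hw : IsPrimitiveFrom w h t₀)
    (hL : ∀ r > 0, ∃ L : ℝ, ∀ᵐ t, t₀ ≤ t → |u t| ≤ r → |w t| ≤ r → w t < u t →
      g t - h t ≤ L * (u t - w t))
    (h0 : u t₀ ≤ w t₀) : ∀ t, t₀ ≤ t → u t ≤ w t := by
  intro s hs
  by_contra! hlt
  have hcu := hu.continuousOn le_rfl hs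
  have hcw := hw.continuousOn le_rfl hs
  obtain ⟨c, ⟨hc1, hc2⟩, hc3, hpos⟩ :=
    exists_last_le hcu hcw ⟨t₀, left_mem_Icc.2 hs, h0⟩
  have hsub : Icc c s ⊆ Icc t₀ s := Icc_subset_Icc_left hc1
  obtain ⟨ru, hru⟩ := isCompact_Icc.exists_bound_of_continuousOn hcu
  obtain ⟨r', hrw⟩ := isCompact_Icc.exists_bound_of_continuousOn hcw
  obtain ⟨L, hL⟩ := hL (max 1 (max ru r')) (by positivity)
  set d : ℝ → ℝ := fun x => max (u (projIcc c s hc2 x) - w (projIcc c s hc2 x)) 0 with hd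
  have hdc : Continuous d := by
    have hv : Continuous fun x => ((projIcc c s hc2 x : Icc c s) : ℝ) :=
      continuous_subtype_val.comp continuous_projIcc
    exact (((hcu.mono hsub).comp_continuous hv fun x => (projIcc c s hc2 x).2).sub
      ((hcw.mono hsub).comp_continuous hv fun x => (projIcc c s hc2 x).2)).max continuous_const
  have hdeq : ∀ x ∈ Icc c s, d x = max (u x - w x) 0 := fun x hx => by
    simp [hd, projIcc_of_mem hc2 hx]
  have hdpos : ∀ x ∈ Ioc c s, d x = u x - w x := fun x hx => by
    rw [hdeq x (Ioc_subset_Icc_self hx)]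
    exact max_eq_left (sub_nonneg.2 (hpos x hx).le)
  have hzero := eq_zero_of_le_mul_integral (K := |L|) (a := c) (b := s) hdc
    (fun x _ => le_max_right _ _) ?_ s (right_mem_Icc.2 hc2)
  · rw [hdeq s (right_mem_Icc.2 hc2)] at hzero
    have := le_max_left (u s - w s) 0
    linarith
  · intro x hx
    rcases hx.1.eq_or_lt with rfl | hcx
    · rw [hdeq _ hx]
      simpa using hc3
    · obtain ⟨hgi, hg⟩ := hu c hc1 x (hc1.trans hx.1) hx.1
      obtain ⟨hhi, hh⟩ := hw c hc1 x (hc1.trans hx.1) hx.1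
      rw [hdpos x ⟨hcx, hx.2⟩, ← intervalIntegral.integral_const_mul]
      have hmono : (∫ t in c..x, (g t - h t)) ≤ ∫ t in c..x, |L| * d t := by
        refine integral_mono_of_ae_Ioc hx.1 (hgi.sub hhi)
          ((hdc.const_mul _).intervalIntegrable _ _) ?_
        filter_upwards [hL] with t ht htm
        have htm' : t ∈ Ioc c s := ⟨htm.1, htm.2.trans hx.2⟩
        have htI : t ∈ Icc t₀ s := hsub (Ioc_subset_Icc_self htm')
        have h1 := ht htI.1 ((hru t htI).trans (by simp)) ((hrw t htI).trans (by simp))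
          (hpos t htm')
        rw [hdpos t htm']
        exact h1.trans (mul_le_mul_of_nonneg_right (le_abs_self L)
          (sub_nonneg.2 (hpos t htm').le))
      rw [intervalIntegral.integral_sub hgi hhi] at hmono
      linarith

/-- A function whose derivative is bounded above by a periodic function of negative mean
wherever the function exceeds `R`, and which does not decrease over a period, is bounded. -/
lemma le_of_le_add_period (hw : IsPrimitiveFrom w g t₀) {T R : ℝ} (hT : 0 < T) {l : ℝ → ℝ}
    (hlT : Function.Periodic l T) (hl : (∫ s in (0:ℝ)..T, l s) < 0)
    (hg : ∀ᵐ t, t₀ ≤ t → R ≤ w t → g t ≤ l t) {a : ℝ} (ha : t₀ ≤ a)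
    (hle : w a ≤ w (a + T)) : w (a + T) ≤ R + ∫ s in (0:ℝ)..T, |l s| := by
  have haT : a ≤ a + T := by linarith
  have hli : ∀ x y, IntervalIntegrable l volume x y :=
    hlT.intervalIntegrable₀ hT.ne' (intervalIntegral.intervalIntegrable_of_integral_ne_zero hl.ne)
  have hint : (∫ s in a..a + T, l s) = ∫ s in (0:ℝ)..T, l s := by
    simpa using hlT.intervalIntegral_add_eq a 0
  have hinta : (∫ s in a..a + T, |l s|) = ∫ s in (0:ℝ)..T, |l s| := by
    have : Function.Periodic (fun s => |l s|) T := fun s => by simp [hlT s]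
    simpa using this.intervalIntegral_add_eq a 0
  by_cases hex : ∃ x ∈ Icc a (a + T), w x ≤ R
  · obtain ⟨c, hc, hcR, hpos⟩ := exists_last_le (hw.continuousOn ha haT) continuousOn_const hex
    obtain ⟨hgi, hgeq⟩ := hw c (ha.trans hc.1) (a + T) (ha.trans haT) hc.2
    have h1 : (∫ s in c..a + T, g s) ≤ ∫ s in c..a + T, |l s| := by
      refine integral_mono_of_ae_Ioc hc.2 hgi (hli _ _).abs ?_
      filter_upwards [hg] with t ht htm
      exact (ht (ha.trans (hc.1.trans htm.1.le)) (hpos t htm).le).trans (le_abs_self _)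
    have h2 : (∫ s in c..a + T, |l s|) ≤ ∫ s in a..a + T, |l s| :=
      intervalIntegral.integral_mono_interval hc.1 hc.2 le_rfl
        (Eventually.of_forall fun x => abs_nonneg _) (hli _ _).abs
    linarith
  · push Not at hex
    obtain ⟨hgi, hgeq⟩ := hw a ha (a + T) (ha.trans haT) haT
    have h1 : (∫ s in a..a + T, g s) ≤ ∫ s in a..a + T, l s := by
      refine integral_mono_of_ae_Ioc haT hgi (hli _ _) ?_
      filter_upwards [hg] with t ht htm
      exact ht (ha.trans htm.1.le) (hex t (Ioc_subset_Icc_self htm)).le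
    linarith

lemma ae_eq (hu : IsPrimitiveFrom u g t₀) (hw : IsPrimitiveFrom w h t₀)
    (huw : ∀ t, t₀ ≤ t → u t = w t) : ∀ᵐ t, t₀ ≤ t → g t = h t := by
  have key : ∀ n : ℕ, ∀ᵐ t, t ∈ Icc t₀ (t₀ + n) → t ≠ t₀ → t ≠ t₀ + n → g t = h t := by
    intro n
    have hn : t₀ ≤ t₀ + n := by simp
    have h1 := (hu t₀ self_mem_Ici _ hn hn).1.ae_hasDerivAt_integral
    have h2 := (hw t₀ self_mem_Ici _ hn hn).1.ae_hasDerivAt_integral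
    filter_upwards [h1, h2] with t ht1 ht2 hm hne hne'
    rw [← uIcc_of_le hn] at hm
    have e1 := ht1 hm t₀ left_mem_uIcc
    have e2 := ht2 hm t₀ left_mem_uIcc
    rw [uIcc_of_le hn] at hm
    refine e1.unique (e2.congr_of_eventuallyEq ?_)
    filter_upwards [Icc_mem_nhds (lt_of_le_of_ne hm.1 hne.symm) (lt_of_le_of_ne hm.2 hne')]
      with x hx
    rw [← (hu t₀ self_mem_Ici x hx.1 hx.1).2, ← (hw t₀ self_mem_Ici x hx.1 hx.1).2, huw x hx.1,
      huw t₀ le_rfl]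
  filter_upwards [ae_all_iff.2 key, Measure.ae_ne volume t₀] with t ht hne hle
  obtain ⟨n, hn⟩ := exists_nat_gt (t - t₀)
  exact ht n ⟨hle, by linarith⟩ hne (by linarith)

end IsPrimitiveFrom

/-- Convergence of integrals for sequences of functions that are decreasing up to a constant. -/
lemma tendsto_integral_of_almost_antitone {g : ℕ → ℝ → ℝ} {G : ℝ → ℝ} {a b K C : ℝ}
    (hab : a ≤ b) (hg : ∀ n, IntervalIntegrable (g n) volume a b)
    (hlim : ∀ᵐ t, t ∈ Ioc a b → Tendsto (fun n => g n t) atTop (𝓝 (G t)))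
    (hK : ∀ᵐ t, t ∈ Ioc a b → ∀ n m, n ≤ m → g m t ≤ g n t + K)
    (hC : ∀ n, C ≤ ∫ t in a..b, g n t) :
    IntervalIntegrable G volume a b ∧
      Tendsto (fun n => ∫ t in a..b, g n t) atTop (𝓝 (∫ t in a..b, G t)) := by
  rw [← ae_restrict_iff' measurableSet_Ioc] at hlim hK
  have hgi : ∀ n, Integrable (g n) (volume.restrict (Ioc a b)) := fun n => (hg n).1
  have hhi : ∀ n, Integrable (fun t => g 0 t + K - g n t) (volume.restrict (Ioc a b)) :=
    fun n => ((hgi 0).add (integrable_const K)).sub (hgi n)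
  have hlim' : ∀ᵐ t ∂volume.restrict (Ioc a b),
      Tendsto (fun n => g 0 t + K - g n t) atTop (𝓝 (g 0 t + K - G t)) :=
    hlim.mono fun t ht => ht.const_sub _
  have hbound : ∀ n, ∫⁻ t in Ioc a b, ‖g 0 t + K - g n t‖ₑ ≤
      ENNReal.ofReal ((∫ t in Ioc a b, (g 0 t + K)) - C) := by
    intro n
    rw [← ofReal_integral_norm_eq_lintegral_enorm (hhi n)]
    refine ENNReal.ofReal_le_ofReal ?_
    have e : ∫ t in Ioc a b, ‖g 0 t + K - g n t‖ = ∫ t in Ioc a b, (g 0 t + K - g n t) :=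
      integral_congr_ae <| hK.mono fun t ht => Real.norm_of_nonneg (by
        have := ht 0 n (Nat.zero_le n); linarith)
    have e' : ∫ t in Ioc a b, (g 0 t + K - g n t) =
        (∫ t in Ioc a b, (g 0 t + K)) - ∫ t in Ioc a b, g n t :=
      integral_sub ((hgi 0).add (integrable_const K)) (hgi n)
    rw [e, e']
    have := hC n
    rw [intervalIntegral.integral_of_le hab] at this
    linarith
  have hHi : Integrable (fun t => g 0 t + K - G t) (volume.restrict (Ioc a b)) := by
    refine integrable_of_tendsto hlim' (fun n => (hhi n).aestronglyMeasurable) ?_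
    refine ne_top_of_le_ne_top ENNReal.ofReal_ne_top
      ((liminf_le_liminf (Eventually.of_forall hbound)).trans_eq (liminf_const _))
  have hGi : Integrable G (volume.restrict (Ioc a b)) := by
    refine (((hgi 0).add (integrable_const K)).sub hHi).congr (Eventually.of_forall fun t => ?_)
    simp
  refine ⟨(intervalIntegrable_iff_integrableOn_Ioc_of_le hab).2 hGi, ?_⟩
  simp only [intervalIntegral.integral_of_le hab]
  refine tendsto_integral_of_dominated_convergence (fun t => |g 0 t + K| + |G t - K|)
    (fun n => (hgi n).aestronglyMeasurable)
    (((hgi 0).add (integrable_const K)).abs.add (hGi.sub (integrable_const K)).abs) ?_ hlim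
  intro n
  filter_upwards [hlim, hK] with t ht hKt
  have h1 : g n t ≤ g 0 t + K := hKt 0 n (Nat.zero_le n)
  have h2 : G t ≤ g n t + K :=
    le_of_tendsto ht ((eventually_ge_atTop n).mono fun m hm => hKt n m hm)
  rw [Real.norm_eq_abs, abs_le]
  have := abs_nonneg (g 0 t + K)
  have := abs_nonneg (G t - K)
  have := le_abs_self (g 0 t + K)
  have := neg_abs_le (G t - K)
  constructor <;> linarith

/-- The graph of a maximal monotone map is sequentially closed. -/
lemma SVMaxMonoInc.mem_of_tendsto {F : ℝ → Set ℝ} (hF : SVMaxMonoInc F) {u y : ℕ → ℝ}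
    {u' y' : ℝ} (hu : Tendsto u atTop (𝓝 u')) (hy : Tendsto y atTop (𝓝 y'))
    (h : ∀ n, y n ∈ F (u n)) : y' ∈ F u' := by
  have key : ∀ x z, z ∈ F x → x ≠ u' → 0 ≤ (y' - z) * (u' - x) := by
    intro x z hz hx
    refine ge_of_tendsto ((hy.sub_const z).mul (hu.sub_const x)) ?_
    filter_upwards [hu.eventually_ne hx.symm] with n hn
    exact hF.1 hz (h n) hn.symm
  refine hF.2 (fun x => {z | z ∈ F x ∨ (x = u' ∧ z = y')}) ?_ (fun x z hz => Or.inl hz) u'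
    (Or.inr ⟨rfl, rfl⟩)
  rintro u₁ u₂ y₁ y₂ (h₁ | ⟨rfl, rfl⟩) (h₂ | ⟨rfl, rfl⟩) hne
  · exact hF.1 h₁ h₂ hne
  · exact key _ _ h₁ hne
  · have := key _ _ h₂ hne.symm
    linarith
  · exact absurd rfl hne

lemma ae_forall_add_nat_mul {P : ℝ → Prop} (h : ∀ᵐ t, P t) (T : ℝ) :
    ∀ᵐ t, ∀ n : ℕ, P (t + n * T) :=
  ae_all_iff.2 fun n =>
    (measurePreserving_add_right volume (n * T)).quasiMeasurePreserving.ae h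

/-- The part of the structural assumption on `G = -A + p` that is used for the asymptotics. -/
structure IsMonotoneSplitting (T : ℝ) (G A : ℝ → ℝ → Set ℝ) (p : ℝ → ℝ → ℝ) : Prop where
  eq : ∀ t u, G t u = {x | ∃ y ∈ A t u, x = -y + p t u}
  nonempty : ∀ t u, (A t u).Nonempty
  periodic : ∀ u, Function.Periodic (fun t => A t u) T
  maxMono : ∀ t, SVMaxMonoInc (A t)
  cont : ∀ t, Continuous fun u => p t u
  periodic' : ∀ u, Function.Periodic (fun t => p t u) T
  lipschitz : ∀ r : ℝ, 0 < r → ∃ L : ℝ, ∀ t u₁ u₂, |u₁| ≤ r → |u₂| ≤ r →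
    |p t u₁ - p t u₂| ≤ L * |u₁ - u₂|

namespace IsMonotoneSplitting

variable {T : ℝ} {G A : ℝ → ℝ → Set ℝ} {p : ℝ → ℝ → ℝ}

lemma mem_iff (h : IsMonotoneSplitting T G A p) {t u x : ℝ} : x ∈ G t u ↔ p t u - x ∈ A t u := by
  rw [h.eq]
  constructor
  · rintro ⟨y, hy, rfl⟩
    simpa using hy
  · exact fun hx => ⟨_, hx, by ring⟩

lemma map_periodic (h : IsMonotoneSplitting T G A p) (t u : ℝ) : G (t + T) u = G t u := by
  have h1 : A (t + T) u = A t u := h.periodic u t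
  have h2 : p (t + T) u = p t u := h.periodic' u t
  rw [h.eq, h.eq, h1, h2]

/-- Solutions of the inclusion are ordered as their initial values. -/
lemma le_of_le (h : IsMonotoneSplitting T G A p) {u g w k : ℝ → ℝ} {t₀ : ℝ}
    (hu : IsPrimitiveFrom u g t₀) (hug : ∀ᵐ t, t₀ ≤ t → g t ∈ G t (u t))
    (hw : IsPrimitiveFrom w k t₀) (hwk : ∀ᵐ t, t₀ ≤ t → k t ∈ G t (w t))
    (h0 : u t₀ ≤ w t₀) : ∀ t, t₀ ≤ t → u t ≤ w t := by
  refine hu.comparison hw (fun r hr => ?_) h0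
  obtain ⟨L, hL⟩ := h.lipschitz r hr
  refine ⟨L, ?_⟩
  filter_upwards [hug, hwk] with t h1 h2 ht hur hwr hlt
  have hm := (h.maxMono t).1 (h.mem_iff.1 (h2 ht)) (h.mem_iff.1 (h1 ht)) hlt.ne
  have hm' := nonneg_of_mul_nonneg_left hm (sub_pos.2 hlt)
  have hp := (le_abs_self _).trans (hL t _ _ hur hwr)
  rw [abs_of_pos (sub_pos.2 hlt)] at hp
  linarith

/-- If the translates of a solution by multiples of the period are monotone and bounded, and so
are the corresponding selections of `A`, then the solution converges to a periodic one. -/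
lemma exists_periodic_limit (h : IsMonotoneSplitting T G A p) (hT : 0 < T)
    {v g : ℝ → ℝ} {t₁ : ℝ} (hv : IsPrimitiveFrom v g t₁)
    (hg : ∀ᵐ t, t₁ ≤ t → g t ∈ G t (v t)) {σ C : ℝ} (hσ : σ = 1 ∨ σ = -1)
    (hmono : ∀ t, t₁ ≤ t → σ * v t ≤ σ * v (t + T))
    (hamono : ∀ᵐ t, t₁ ≤ t → σ * (p t (v t) - g t) ≤ σ * (p t (v (t + T)) - g (t + T)))
    (hC : ∀ t, t₁ ≤ t → σ * v t ≤ C) :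
    ∃ w : ℝ → ℝ, IsSolOn G w univ ∧ Function.Periodic w T ∧
      Tendsto (fun t => v t - w t) atTop (𝓝 0) := by
  have hσσ : ∀ x, σ * (σ * x) = x := by rcases hσ with rfl | rfl <;> simp
  have hσabs : ∀ x, |σ * x| = |x| := by rcases hσ with rfl | rfl <;> simp
  have hstep : ∀ (n : ℕ) (t : ℝ), t + ((n + 1 : ℕ) : ℝ) * T = t + n * T + T := by
    intro n t; push_cast; ring
  have hle_add : ∀ (n : ℕ) (t : ℝ), t ≤ t + n * T := fun n t => by
    have : 0 ≤ (n : ℝ) * T := by positivity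
    linarith
  have hper_p : ∀ (n : ℕ) (t u : ℝ), p (t + n * T) u = p t u := fun n t u =>
    (h.periodic' u).nat_mul n t
  have hper_A : ∀ (n : ℕ) (t u : ℝ), A (t + n * T) u = A t u := fun n t u =>
    (h.periodic u).nat_mul n t
  have hlate : ∀ t, ∃ N : ℕ, t₁ ≤ t + N * T := fun t => by
    obtain ⟨N, hN⟩ := exists_nat_ge ((t₁ - t) / T)
    rw [div_le_iff₀ hT] at hN
    exact ⟨N, by linarith⟩
  have hlate' : ∀ {t : ℝ} {N : ℕ}, t₁ ≤ t + N * T → ∀ n, N ≤ n → t₁ ≤ t + n * T := by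
    intro t N hN n hn
    have : (N : ℝ) * T ≤ n * T := by gcongr
    linarith
  have hvmono : ∀ t, t₁ ≤ t → Monotone fun n : ℕ => σ * v (t + n * T) := fun t ht =>
    monotone_nat_of_le_succ fun n => by
      rw [hstep]
      exact hmono _ (ht.trans (hle_add n t))
  have hshift : ∀ (t : ℝ) (N n : ℕ), t + N * T + n * T = t + ((n + N : ℕ) : ℝ) * T := by
    intro t N n; push_cast; ring
  have hex : ∀ t, ∃ l, Tendsto (fun n : ℕ => v (t + n * T)) atTop (𝓝 l) := by
    intro t
    obtain ⟨N, hN⟩ := hlate t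
    have hb : BddAbove (range fun n : ℕ => σ * v (t + N * T + n * T)) :=
      ⟨C, by rintro _ ⟨n, rfl⟩; exact hC _ (hN.trans (hle_add n _))⟩
    have hl := (tendsto_atTop_ciSup (hvmono _ hN) hb).const_mul σ
    simp only [hσσ, hshift] at hl
    exact ⟨_, (tendsto_add_atTop_iff_nat N).1 hl⟩
  choose w hw using hex
  have hwper : Function.Periodic w T := by
    intro t
    have h1 := (tendsto_add_atTop_iff_nat 1).2 (hw t)
    refine tendsto_nhds_unique (hw (t + T)) (h1.congr fun n => ?_)
    rw [hstep]
    congr 1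
    ring
  have hvw : ∀ t (n : ℕ), t₁ ≤ t + n * T → σ * v (t + n * T) ≤ σ * w t := by
    intro t n hn
    have h1 := (hvmono _ hn).ge_of_tendsto (b := 0) (a := σ * w t) (by
      simp only [hshift]
      exact ((tendsto_add_atTop_iff_nat n).2 (hw t)).const_mul σ)
    simpa using h1
  have hgood : ∀ᵐ t, ∀ n : ℕ, t₁ ≤ t + n * T →
      p t (v (t + n * T)) - g (t + n * T) ∈ A t (v (t + n * T)) ∧
      σ * (p t (v (t + n * T)) - g (t + n * T)) ≤
        σ * (p t (v (t + ((n + 1 : ℕ) : ℝ) * T)) - g (t + ((n + 1 : ℕ) : ℝ) * T)) := by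
    filter_upwards [ae_forall_add_nat_mul hg T, ae_forall_add_nat_mul hamono T]
      with t h1 h2 n hn
    have h1' := h.mem_iff.1 (h1 n hn)
    have h2' := h2 n hn
    rw [hper_p, hper_A] at h1'
    rw [hper_p, hper_p] at h2'
    rw [hstep]
    exact ⟨h1', h2'⟩
  set k : ℝ → ℝ := fun t => limUnder atTop fun n : ℕ => g (t + n * T) with hk
  have hlim : ∀ᵐ t, Tendsto (fun n : ℕ => g (t + n * T)) atTop (𝓝 (k t)) ∧
      k t ∈ G t (w t) := by
    filter_upwards [hgood] with t ht
    obtain ⟨N, hN⟩ := hlate t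
    have hN' : ∀ n : ℕ, t₁ ≤ t + ((n + N : ℕ) : ℝ) * T := fun n => hlate' hN _ (by omega)
    set q : ℕ → ℝ := fun n =>
      p t (v (t + ((n + N : ℕ) : ℝ) * T)) - g (t + ((n + N : ℕ) : ℝ) * T) with hq
    have hqA : ∀ n, q n ∈ A t (v (t + ((n + N : ℕ) : ℝ) * T)) := fun n => (ht _ (hN' n)).1
    have hqm : Monotone fun n => σ * q n := monotone_nat_of_le_succ fun n => by
      have := (ht _ (hN' n)).2
      simp only [hq]
      rwa [show n + 1 + N = n + N + 1 by omega]
    obtain ⟨y, hy⟩ := h.nonempty t (w t + σ)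
    have hqb : BddAbove (range fun n => σ * q n) := by
      refine ⟨σ * y, ?_⟩
      rintro _ ⟨n, rfl⟩
      have h1 := hvw t _ (hN' n)
      have h2 : v (t + ((n + N : ℕ) : ℝ) * T) ≠ w t + σ := by
        intro he
        rw [he] at h1
        rcases hσ with rfl | rfl <;> linarith
      have h3 := (h.maxMono t).1 (hqA n) hy h2
      simp only
      rcases hσ with rfl | rfl
      · have := nonneg_of_mul_nonneg_left h3 (by linarith)
        linarith
      · rw [← neg_mul_neg] at h3
        have := nonneg_of_mul_nonneg_left h3 (by linarith)
        linarith
    have hql := (tendsto_atTop_ciSup hqm hqb).const_mul σ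
    simp only [hσσ] at hql
    have hwl := (tendsto_add_atTop_iff_nat N).2 (hw t)
    have hmem := (h.maxMono t).mem_of_tendsto hwl hql hqA
    have hgl := (((h.cont t).tendsto (w t)).comp hwl).sub hql
    have hgl' : Tendsto (fun n : ℕ => g (t + n * T)) atTop
        (𝓝 (p t (w t) - σ * ⨆ n, σ * q n)) := by
      refine (tendsto_add_atTop_iff_nat N).1 (hgl.congr fun n => ?_)
      simp [hq]
    have hkt : k t = p t (w t) - σ * ⨆ n, σ * q n := hgl'.limUnder_eq
    rw [hkt]
    refine ⟨hgl', h.mem_iff.2 ?_⟩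
    rwa [sub_sub_cancel]
  have hprim : ∀ a b, a ≤ b → IntervalIntegrable k volume a b ∧
      w b - w a = ∫ s in a..b, k s := by
    intro a b hab
    obtain ⟨N, hN⟩ := hlate a
    have hN' : ∀ n : ℕ, t₁ ≤ a + ((n + N : ℕ) : ℝ) * T := fun n => hlate' hN _ (by omega)
    have hvn : ∀ n : ℕ, IsPrimitiveFrom (fun t => v (t + ((n + N : ℕ) : ℝ) * T))
        (fun t => g (t + ((n + N : ℕ) : ℝ) * T)) a := by
      intro n x hx y hy hxy
      simp only [mem_Ici] at hx hy
      have := hN' n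
      obtain ⟨h1, h2⟩ := hv (x + ((n + N : ℕ) : ℝ) * T) (by simp only [mem_Ici]; linarith)
        (y + ((n + N : ℕ) : ℝ) * T) (by simp only [mem_Ici]; linarith) (by linarith)
      refine ⟨by simpa using h1.comp_add_right (((n + N : ℕ) : ℝ) * T), ?_⟩
      rw [intervalIntegral.integral_comp_add_right]
      exact h2
    obtain ⟨r₀, hr₀⟩ := isCompact_Icc.exists_bound_of_continuousOn
      ((hvn 0).continuousOn le_rfl hab)
    obtain ⟨L, hL⟩ := h.lipschitz (max 1 (max r₀ |C|)) (by positivity)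
    set r := max 1 (max r₀ |C|)
    have hbd : ∀ t ∈ Icc a b, ∀ n : ℕ, |v (t + ((n + N : ℕ) : ℝ) * T)| ≤ r := by
      intro t ht n
      have htn : t₁ ≤ t + N * T := by linarith [ht.1]
      have h1 : σ * v (t + N * T) ≤ σ * v (t + ((n + N : ℕ) : ℝ) * T) := by
        have := hvmono _ htn (Nat.zero_le n)
        simpa only [hshift, zero_add] using this
      have h2 := hC (t + ((n + N : ℕ) : ℝ) * T) (by linarith [ht.1, hN' n])
      have h3 : |σ * v (t + N * T)| ≤ r₀ := by
        rw [hσabs]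
        simpa using hr₀ t ht
      have h4 : r₀ ≤ r := (le_max_left _ _).trans (le_max_right _ _)
      have h5 : |C| ≤ r := (le_max_right _ _).trans (le_max_right _ _)
      rw [← hσabs, abs_le]
      constructor
      · linarith [neg_le_of_abs_le h3]
      · linarith [le_abs_self C]
    have hpd : ∀ t ∈ Icc a b, ∀ n m : ℕ, σ * (p t (v (t + ((m + N : ℕ) : ℝ) * T)) -
        p t (v (t + ((n + N : ℕ) : ℝ) * T))) ≤ |L| * (2 * r) := by
      intro t ht n m
      refine (le_abs_self _).trans ?_
      rw [hσabs]
      refine (hL t _ _ (hbd t ht m) (hbd t ht n)).trans ?_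
      refine mul_le_mul (le_abs_self L) ?_ (abs_nonneg _) (abs_nonneg _)
      refine (abs_sub _ _).trans ?_
      linarith [hbd t ht m, hbd t ht n]
    have hint : ∀ n : ℕ, v (b + ((n + N : ℕ) : ℝ) * T) - v (a + ((n + N : ℕ) : ℝ) * T) =
        ∫ t in a..b, g (t + ((n + N : ℕ) : ℝ) * T) := fun n =>
      (hvn n a self_mem_Ici b hab hab).2
    obtain ⟨hki, hkl⟩ := tendsto_integral_of_almost_antitone
      (g := fun n t => σ * g (t + ((n + N : ℕ) : ℝ) * T)) (G := fun t => σ * k t)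
      (K := |L| * (2 * r)) (C := σ * v (b + N * T) - C) hab
      (fun n => ((hvn n a self_mem_Ici b hab hab).1.const_mul σ))
      (by
        filter_upwards [hlim] with t ht _
        exact ((tendsto_add_atTop_iff_nat N).2 ht.1).const_mul σ)
      (by
        filter_upwards [hgood] with t ht htI n m hnm
        have htI' := Ioc_subset_Icc_self htI
        have hqm : Monotone fun n : ℕ => σ * (p t (v (t + ((n + N : ℕ) : ℝ) * T)) -
            g (t + ((n + N : ℕ) : ℝ) * T)) := monotone_nat_of_le_succ fun n => by
          have := (ht (n + N) (by linarith [htI.1, hN' n])).2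
          rwa [show n + 1 + N = n + N + 1 by omega]
        have h1 := hqm hnm
        have h2 := hpd t htI' n m
        simp only [mul_sub] at h1 h2 ⊢
        linarith)
      (by
        intro n
        rw [intervalIntegral.integral_const_mul, ← hint, mul_sub]
        have h1 : σ * v (b + N * T) ≤ σ * v (b + ((n + N : ℕ) : ℝ) * T) := by
          have := hvmono (b + N * T) (by linarith) (Nat.zero_le n)
          simpa only [hshift, zero_add] using this
        linarith [hC _ (hN' n)])
    refine ⟨(hki.const_mul σ).congr fun t _ => hσσ (k t), ?_⟩
    have h1 := hkl.const_mul σ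
    simp only [intervalIntegral.integral_const_mul, hσσ, ← hint] at h1
    exact tendsto_nhds_unique (((tendsto_add_atTop_iff_nat N).2 (hw b)).sub
      ((tendsto_add_atTop_iff_nat N).2 (hw a))) h1
  refine ⟨w, ⟨k, fun a _ b _ hab => hprim a b hab, hlim.mono fun t ht _ => ht.2⟩, hwper, ?_⟩
  have htT : t₁ ≤ t₁ + T := by linarith
  have hwc : ContinuousOn w (Icc t₁ (t₁ + T)) :=
    IsPrimitiveFrom.continuousOn (t₀ := t₁) (fun a _ b _ hab => hprim a b hab) le_rfl htT
  have hunif := Monotone.tendstoUniformlyOn_of_forall_tendsto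
    (F := fun (n : ℕ) t => σ * v (t + n * T)) (f := fun t => σ * w t)
    (isCompact_Icc (a := t₁) (b := t₁ + T))
    (fun n => ((hv.comp_add (c := n * T) (by positivity)).continuousOn le_rfl htT).const_mul σ)
    (fun t ht => hvmono t ht.1) (hwc.const_mul σ) (fun t _ => (hw t).const_mul σ)
  rw [Metric.tendstoUniformlyOn_iff] at hunif
  rw [Metric.tendsto_atTop]
  intro ε hε
  obtain ⟨N, hN⟩ := eventually_atTop.1 (hunif ε hε)
  refine ⟨t₁ + N * T, fun t ht => ?_⟩
  have ht0 : 0 ≤ (t - t₁) / T := by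
    have := hle_add N t₁
    exact div_nonneg (by linarith) hT.le
  have hfl := Nat.floor_le ht0
  have hlt := Nat.lt_floor_add_one ((t - t₁) / T)
  have hNn : N ≤ ⌊(t - t₁) / T⌋₊ := Nat.le_floor (by rw [le_div_iff₀ hT]; linarith)
  set n := ⌊(t - t₁) / T⌋₊
  rw [le_div_iff₀ hT] at hfl
  rw [div_lt_iff₀ hT] at hlt
  have h1 := hN n hNn (t - n * T) ⟨by linarith, by linarith⟩
  have h2 : w (t - n * T) = w t := hwper.sub_nat_mul_eq n
  rw [h2, sub_add_cancel, dist_comm, Real.dist_eq, ← mul_sub, hσabs] at h1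
  simpa [Real.dist_eq] using h1

end IsMonotoneSplitting

/-- Under (S1) and (S2), every solution of `v̇ ∈ G(t,v)` on `[t₀,∞)`
converges to a `T`-periodic solution `v*` with `v* 0 ∈ [v₋, v₊]`. -/
theorem asymptotically_periodic (T : ℝ) (hT : 0 < T) (G : ℝ → ℝ → Set ℝ)
    (hS1 : SatS1 T G) (R : ℝ) (ℓm ℓp : ℝ → ℝ) (hS2 : S2Data T G R ℓm ℓp)
    (t₀ : ℝ) (v : ℝ → ℝ) (hv : IsSolOn G v (Set.Ici t₀)) :
    ∃ vstar : ℝ → ℝ, IsSolOn G vstar Set.univ ∧ Function.Periodic vstar T ∧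
      vstar 0 ∈ Set.Icc (-R - ∫ s in (0:ℝ)..T, |ℓm s|) (R + ∫ s in (0:ℝ)..T, |ℓp s|) ∧
      Tendsto (fun t => v t - vstar t) atTop (𝓝 0) := by
  obtain ⟨A, p, hG, hne, hAper, -, -, hmax, -, hcont, hpper, hlip⟩ := hS1
  have h : IsMonotoneSplitting T G A p := ⟨hG, hne, hAper, hmax, hcont, hpper, hlip⟩
  obtain ⟨-, -, -, hℓmT, hℓpT, hℓm, hℓp, hlow, hup⟩ := hS2
  have upper : ∀ {w k : ℝ → ℝ} {t₁ : ℝ}, IsPrimitiveFrom w k t₁ →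
      (∀ᵐ t, t₁ ≤ t → k t ∈ G t (w t)) → ∀ a, t₁ ≤ a → w a ≤ w (a + T) →
      w (a + T) ≤ R + ∫ s in (0:ℝ)..T, |ℓp s| := by
    intro w k t₁ hw hk a ha hle
    refine hw.le_of_le_add_period hT hℓpT hℓp ?_ ha hle
    filter_upwards [hk, hup] with t h1 h2 ht hR
    exact h2 _ hR _ (h1 ht)
  have lower : ∀ {w k : ℝ → ℝ} {t₁ : ℝ}, IsPrimitiveFrom w k t₁ →
      (∀ᵐ t, t₁ ≤ t → k t ∈ G t (w t)) → ∀ a, t₁ ≤ a → w (a + T) ≤ w a →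
      -w (a + T) ≤ R + ∫ s in (0:ℝ)..T, |ℓm s| := by
    intro w k t₁ hw hk a ha hle
    refine hw.neg.le_of_le_add_period hT hℓmT hℓm ?_ ha (neg_le_neg hle)
    filter_upwards [hk, hlow] with t h1 h2 ht hR
    have := h2 _ (by linarith) _ (h1 ht)
    linarith
  suffices hex : ∃ w : ℝ → ℝ, IsSolOn G w univ ∧ Function.Periodic w T ∧
      Tendsto (fun t => v t - w t) atTop (𝓝 0) by
    obtain ⟨w, hw, hwT, hlim⟩ := hex
    refine ⟨w, hw, hwT, ?_, hlim⟩
    obtain ⟨k, hk, hkG⟩ := hw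
    have hk0 : IsPrimitiveFrom w k 0 := fun a _ b _ hab => hk a trivial b trivial hab
    have hkG0 : ∀ᵐ t, 0 ≤ t → k t ∈ G t (w t) := hkG.mono fun t ht _ => ht trivial
    have h1 := upper hk0 hkG0 0 le_rfl (hwT 0).ge
    have h2 := lower hk0 hkG0 0 le_rfl (hwT 0).le
    rw [hwT 0] at h1 h2
    exact ⟨by linarith, h1⟩
  obtain ⟨g, hvg, hg⟩ := hv
  change IsPrimitiveFrom v g t₀ at hvg
  change ∀ᵐ t, t₀ ≤ t → g t ∈ G t (v t) at hg
  have hvgT := hvg.comp_add hT.le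
  have hgT : ∀ᵐ t, t₀ ≤ t → g (t + T) ∈ G t (v (t + T)) := by
    filter_upwards [ae_forall_add_nat_mul hg T] with t h1 ht
    have h2 := h1 1
    rw [Nat.cast_one, one_mul, h.map_periodic] at h2
    exact h2 (by linarith)
  by_cases hmeet : ∃ t₁, t₀ ≤ t₁ ∧ v t₁ = v (t₁ + T)
  · obtain ⟨t₁, ht₁, heq⟩ := hmeet
    have hg₁ : ∀ᵐ t, t₁ ≤ t → g t ∈ G t (v t) := hg.mono fun t ht hle => ht (ht₁.trans hle)
    have hgT₁ : ∀ᵐ t, t₁ ≤ t → g (t + T) ∈ G t (v (t + T)) :=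
      hgT.mono fun t ht hle => ht (ht₁.trans hle)
    have hper : ∀ t, t₁ ≤ t → v t = v (t + T) := fun t ht => le_antisymm
      (h.le_of_le (hvg.mono ht₁) hg₁ (hvgT.mono ht₁) hgT₁ heq.le t ht)
      (h.le_of_le (hvgT.mono ht₁) hgT₁ (hvg.mono ht₁) hg₁ heq.ge t ht)
    refine h.exists_periodic_limit hT (C := R + ∫ s in (0:ℝ)..T, |ℓp s|)
      (hvg.mono ht₁) hg₁ (Or.inl rfl) (fun t ht => by rw [← hper t ht]) ?_ (fun t ht => ?_)
    · filter_upwards [(hvg.mono ht₁).ae_eq (hvgT.mono ht₁) hper] with t h1 ht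
      rw [← hper t ht, ← h1 ht]
    · rw [one_mul, hper t ht]
      exact upper (hvg.mono ht₁) hg₁ t ht (hper t ht).le
  · push Not at hmeet
    rcases le_total (v t₀) (v (t₀ + T)) with h0 | h0
    · have hmono := h.le_of_le hvg hg hvgT hgT h0
      refine h.exists_periodic_limit hT (C := R + ∫ s in (0:ℝ)..T, |ℓp s|) hvg hg (Or.inl rfl)
        (fun t ht => by simpa using hmono t ht) ?_ (fun t ht => ?_)
      · filter_upwards [hg, hgT] with t h1 h2 ht
        have h3 := (h.maxMono t).1 (h.mem_iff.1 (h1 ht)) (h.mem_iff.1 (h2 ht)) (hmeet t ht)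
        have := nonneg_of_mul_nonneg_left h3
          (sub_pos.2 (lt_of_le_of_ne (hmono t ht) (hmeet t ht)))
        linarith
      · rw [one_mul]
        exact (hmono t ht).trans (upper hvg hg t ht (hmono t ht))
    · have hmono := h.le_of_le hvgT hgT hvg hg h0
      refine h.exists_periodic_limit hT (C := R + ∫ s in (0:ℝ)..T, |ℓm s|) hvg hg (Or.inr rfl)
        (fun t ht => by simpa using hmono t ht) ?_ (fun t ht => ?_)
      · filter_upwards [hg, hgT] with t h1 h2 ht
        have h3 := (h.maxMono t).1 (h.mem_iff.1 (h2 ht)) (h.mem_iff.1 (h1 ht)) (hmeet t ht).symm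
        have := nonneg_of_mul_nonneg_left h3
          (sub_pos.2 (lt_of_le_of_ne (hmono t ht) (hmeet t ht).symm))
        linarith
      · rw [neg_one_mul]
        exact (neg_le_neg (hmono t ht)).trans (lower hvg hg t ht (hmono t ht))
end

section
/- Let G : ℝ × ℝ → P(ℝ) be such that for every t the map u ↦ G(t,u) is monotone decreasing, i.e. (y₂ − y₁)(u₂ − u₁) ≤ 0 whenever u₁ ≠ u₂ and y_i ∈ G(t,u_i). If u and v are two solutions of the differential inclusion ẏ ∈ G(t,y) on an interval [t*, ∞), then the function t ↦ |u(t) − v(t)| is nonincreasing on [t*, ∞). -/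
open MeasureTheory Set Filter Topology

/-- A set-valued map `F : ℝ → P(ℝ)` is monotone decreasing. -/
def SVMonoDec (F : ℝ → Set ℝ) : Prop :=
  ∀ ⦃u₁ u₂ y₁ y₂ : ℝ⦄, y₁ ∈ F u₁ → y₂ ∈ F u₂ → u₁ ≠ u₂ → (y₂ - y₁) * (u₂ - u₁) ≤ 0

/-- A primitive `w` of an integrable `h` with `w * h ≤ 0` a.e. does not increase in absolute
value. -/
theorem abs_le_abs_of_ae_mul_nonpos {w h : ℝ → ℝ} {a b : ℝ} (hab : a ≤ b)
    (hh : IntervalIntegrable h volume a b)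
    (hw : ∀ x ∈ Set.Icc a b, w x = w a + ∫ s in a..x, h s)
    (hwh : ∀ᵐ t ∂(volume : Measure ℝ), t ∈ Set.Icc a b → w t * h t ≤ 0) :
    |w b| ≤ |w a| := by
  let W : ℝ → ℝ := fun x => w a + ∫ s in a..x, h s
  have hconst : AbsolutelyContinuousOnInterval (fun _ : ℝ => w a) a b :=
    (LipschitzWith.const (w a)).lipschitzOnWith.absolutelyContinuousOnInterval
  have hW : AbsolutelyContinuousOnInterval W a b :=
    hconst.add (hh.absolutelyContinuousOnInterval_intervalIntegral left_mem_uIcc)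
  have hint := hW.integral_deriv_mul_eq_sub hW
  have hnonneg : 0 ≤ ∫ x in a..b, -(deriv W x * W x + W x * deriv W x) := by
    refine intervalIntegral.integral_nonneg_of_ae_restrict hab ?_
    refine (ae_restrict_iff' measurableSet_Icc).mpr ?_
    filter_upwards [hh.ae_hasDerivAt_integral, hwh] with x hx hwx hxI
    have hd : deriv W x = h x :=
      ((hx (Set.Icc_subset_uIcc hxI) a left_mem_uIcc).const_add (w a)).deriv
    have hWx : W x = w x := (hw x hxI).symm
    have := hwx hxI
    simp only [Pi.zero_apply, hd, hWx]
    linarith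
  rw [intervalIntegral.integral_neg, hint] at hnonneg
  have hWa : W a = w a := (hw a (left_mem_Icc.2 hab)).symm
  have hWb : W b = w b := (hw b (right_mem_Icc.2 hab)).symm
  rw [hWa, hWb] at hnonneg
  exact abs_le_iff_mul_self_le.2 (by linarith)

/-- If `G(t,·)` is monotone decreasing for every `t` and `u`, `v` are two
solutions of `ẏ ∈ G(t,y)` on `[t*,∞)`, then `t ↦ |u(t) - v(t)|` is nonincreasing there. -/
theorem monotone_dec_contraction (G : ℝ → ℝ → Set ℝ)
    (hmono : ∀ t, SVMonoDec (G t))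
    (tstar : ℝ) (u v : ℝ → ℝ)
    (hu : IsSolOn G u (Set.Ici tstar)) (hv : IsSolOn G v (Set.Ici tstar)) :
    AntitoneOn (fun t => |u t - v t|) (Set.Ici tstar) := by
  obtain ⟨g, hg, hgG⟩ := hu
  obtain ⟨k, hk, hkG⟩ := hv
  intro a ha b hb hab
  refine abs_le_abs_of_ae_mul_nonpos (w := fun t => u t - v t) (h := fun t => g t - k t) hab
    ((hg a ha b hb hab).1.sub (hk a ha b hb hab).1) (fun x hx => ?_) ?_
  · have hxI : x ∈ Set.Ici tstar := le_trans (Set.mem_Ici.1 ha) hx.1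
    obtain ⟨hgi, hgx⟩ := hg a ha x hxI hx.1
    obtain ⟨hki, hkx⟩ := hk a ha x hxI hx.1
    rw [intervalIntegral.integral_sub hgi hki]
    linarith
  · filter_upwards [hgG, hkG] with t hgt hkt ht
    have htI : t ∈ Set.Ici tstar := le_trans (Set.mem_Ici.1 ha) ht.1
    by_cases huv : u t = v t
    · simp [huv]
    · linarith [hmono t (hkt htI) (hgt htI) (Ne.symm huv)]
end

section
/- Let G : ℝ × ℝ → ℝ be a single-valued, continuous function, T-periodic in the first variable, monotone decreasing in the second variable, satisfying the dissipativity assumption (S2), and suppose that for every t there exists a unique u_t ∈ ℝ such that G(t, u_t) = 0. Then the differential equation v̇ = G(t,v) admits exactly one T-periodic solution v*, and v* is a global attractor: every solution v on an interval [t₀, ∞) satisfies lim_{t→+∞} (v(t) − v*(t)) = 0. -/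
open MeasureTheory Set Filter Topology

/-- `v` is continuous on `s` and is an indefinite integral of `p` there. -/
def IsPrimitiveOn (v p : ℝ → ℝ) (s : Set ℝ) : Prop :=
  ContinuousOn v s ∧ ∀ a ∈ s, ∀ b ∈ s, a ≤ b →
    IntervalIntegrable p volume a b ∧ v b - v a = ∫ x in a..b, p x

namespace IsPrimitiveOn

variable {v w p q : ℝ → ℝ} {s t : Set ℝ}

theorem mono (h : IsPrimitiveOn v p s) (hts : t ⊆ s) : IsPrimitiveOn v p t :=
  ⟨h.1.mono hts, fun a ha b hb hab => h.2 a (hts ha) b (hts hb) hab⟩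

theorem neg (h : IsPrimitiveOn v p s) : IsPrimitiveOn (fun x => -v x) (fun x => -p x) s := by
  refine ⟨h.1.neg, fun a ha b hb hab => ?_⟩
  obtain ⟨h1, h2⟩ := h.2 a ha b hb hab
  refine ⟨h1.neg, ?_⟩
  rw [intervalIntegral.integral_neg, ← h2]
  ring

theorem const (c : ℝ) (s : Set ℝ) : IsPrimitiveOn (fun _ => c) (fun _ => 0) s :=
  ⟨continuousOn_const, fun a _ b _ _ => ⟨by simp, by simp⟩⟩

theorem of_hasDerivAt (h : ∀ x, HasDerivAt v (p x) x) (hp : Continuous p) (s : Set ℝ) :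
    IsPrimitiveOn v p s := by
  refine ⟨fun x _ => (h x).continuousAt.continuousWithinAt, fun a _ b _ _ => ?_⟩
  have hi := hp.intervalIntegrable (μ := volume) a b
  exact ⟨hi, (intervalIntegral.integral_eq_sub_of_hasDerivAt (fun x _ => h x) hi).symm⟩

/-- If `v - w` grows at rate at most `ε` wherever it exceeds `c`, then it exceeds `c` by at most
`ε` times the elapsed time. -/
theorem sub_le {a b c ε : ℝ} (hab : a ≤ b) (hv : IsPrimitiveOn v p (Icc a b))
    (hw : IsPrimitiveOn w q (Icc a b)) (hε : 0 ≤ ε)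
    (h : ∀ x ∈ Icc a b, c < v x - w x → p x ≤ q x + ε) (h0 : v a - w a ≤ c) :
    v b - w b ≤ c + ε * (b - a) := by
  have hd : ContinuousOn (fun x => v x - w x) (Icc a b) := hv.1.sub hw.1
  have hK : IsCompact (Icc a b ∩ (fun x => v x - w x) ⁻¹' Iic c) :=
    isCompact_Icc.of_isClosed_subset (hd.preimage_isClosed_of_isClosed isClosed_Icc isClosed_Iic)
      inter_subset_left
  obtain ⟨x, ⟨hx, hxc⟩, hmax⟩ := hK.exists_isGreatest ⟨a, left_mem_Icc.2 hab, h0⟩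
  have hxc' : v x - w x ≤ c := hxc
  have hb : b ∈ Icc a b := right_mem_Icc.2 hab
  obtain ⟨hp, hvx⟩ := hv.2 x hx b hb hx.2
  obtain ⟨hq, hwx⟩ := hw.2 x hx b hb hx.2
  have hle : ∫ y in x..b, p y ≤ ∫ y in x..b, (q y + ε) := by
    refine intervalIntegral.integral_mono_on_of_le_Ioo hx.2 hp
      (hq.add intervalIntegrable_const) fun y hy => ?_
    have hy' : y ∈ Icc a b := ⟨hx.1.trans hy.1.le, hy.2.le⟩
    refine h y hy' ?_
    by_contra hcon
    exact absurd (hmax ⟨hy', not_lt.1 hcon⟩) (not_le.2 hy.1)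
  rw [intervalIntegral.integral_add hq intervalIntegrable_const,
    intervalIntegral.integral_const, smul_eq_mul] at hle
  nlinarith [hx.1, mul_le_mul_of_nonneg_left hx.1 hε]

end IsPrimitiveOn

theorem IsSolOn.isPrimitiveOn {G : ℝ → ℝ → ℝ} {v : ℝ → ℝ} {t₀ : ℝ}
    (h : IsSolOn (fun t u => {G t u}) v (Ici t₀)) :
    IsPrimitiveOn v (fun t => G t (v t)) (Ici t₀) := by
  obtain ⟨g, hg, hgG⟩ := h
  have hv : ContinuousOn v (Ici t₀) := by
    refine continuousOn_of_locally_continuousOn fun x hx => ⟨Iio (x + 1), isOpen_Iio, by simp, ?_⟩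
    have hx' : t₀ ≤ x + 1 := le_add_of_le_of_nonneg hx zero_le_one
    have hi := (hg t₀ self_mem_Ici (x + 1) hx' hx').1
    have hc := intervalIntegral.continuousOn_primitive_interval' hi left_mem_uIcc
    rw [uIcc_of_le hx'] at hc
    refine ((hc.const_add (v t₀)).congr fun y hy => ?_).mono fun y hy => ⟨hy.1, le_of_lt hy.2⟩
    have := (hg t₀ self_mem_Ici y hy.1 hy.1).2
    linarith
  refine ⟨hv, fun a ha b hb hab => ?_⟩
  obtain ⟨h1, h2⟩ := hg a ha b hb hab
  have hae : ∀ᵐ t ∂(volume : Measure ℝ), t ∈ uIoc a b → g t = G t (v t) := by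
    filter_upwards [hgG] with t ht htab
    rw [uIoc_of_le hab] at htab
    exact ht (le_trans ha htab.1.le)
  refine ⟨h1.congr_ae ((ae_restrict_iff' measurableSet_uIoc).2 hae), ?_⟩
  rw [h2]
  exact intervalIntegral.integral_congr_ae hae

/-- A vector field that is bounded and uniformly continuous in space has approximate solutions,
which solve the equation for its averages over short intervals. -/
theorem exists_approximate_solution {F : ℝ → ℝ → ℝ} {T C : ℝ} (hT : 0 ≤ T)
    (hF : Continuous fun q : ℝ × ℝ => F q.1 q.2) (hC : ∀ t ∈ Icc 0 T, ∀ u, |F t u| ≤ C)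
    (hunif : ∀ ε > 0, ∃ δ > 0, ∀ t ∈ Icc 0 T, ∀ u w, |u - w| ≤ δ → |F t u - F t w| ≤ ε)
    (x : ℝ) {ε : ℝ} (hε : 0 < ε) :
    ∃ φ p : ℝ → ℝ, IsPrimitiveOn φ p (Icc 0 T) ∧ φ 0 = x ∧
      ∀ t ∈ Icc 0 T, |p t - F t (φ t)| ≤ ε := by
  obtain ⟨δ, hδ, hδF⟩ := hunif ε hε
  have hC0 : 0 ≤ C := (abs_nonneg _).trans (hC 0 (left_mem_Icc.2 hT) 0)
  set H : ℝ → ℝ → ℝ := fun t u => δ⁻¹ * ∫ s in (0:ℝ)..δ, F t (u + s) with hH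
  have hFt : ∀ t, Continuous (F t) := fun t => hF.comp (by fun_prop : Continuous fun u => (t, u))
  have hHcont : Continuous fun q : ℝ × ℝ => H q.1 q.2 := by
    refine continuous_const.mul
      (intervalIntegral.continuous_parametric_intervalIntegral_of_continuous' ?_ 0 δ)
    exact hF.comp (by fun_prop : Continuous fun z : (ℝ × ℝ) × ℝ => (z.1.1, z.1.2 + z.2))
  have hHC : ∀ t ∈ Icc 0 T, ∀ u, |H t u| ≤ C := by
    intro t ht u
    have h1 := intervalIntegral.norm_integral_le_of_norm_le_const (a := 0) (b := δ) (C := C)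
      (f := fun s => F t (u + s)) fun s _ => hC t ht _
    rw [sub_zero, abs_of_pos hδ, Real.norm_eq_abs] at h1
    rw [hH, abs_mul, abs_of_pos (inv_pos.2 hδ), inv_mul_le_iff₀ hδ]
    linarith
  have hHF : ∀ t ∈ Icc 0 T, ∀ u, |H t u - F t u| ≤ ε := by
    intro t ht u
    have h1 := intervalIntegral.norm_integral_le_of_norm_le_const (a := 0) (b := δ) (C := ε)
      (f := fun s => F t (u + s) - F t u) fun s hs => by
        rw [uIoc_of_le hδ.le] at hs
        refine hδF t ht _ _ ?_
        rw [add_sub_cancel_left, abs_of_pos hs.1]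
        exact hs.2
    have hi : IntervalIntegrable (fun s => F t (u + s)) volume 0 δ :=
      ((hFt t).comp (continuous_const_add u)).intervalIntegrable _ _
    rw [intervalIntegral.integral_sub hi intervalIntegrable_const,
      intervalIntegral.integral_const, sub_zero, abs_of_pos hδ, Real.norm_eq_abs, smul_eq_mul] at h1
    have h2 : H t u - F t u = δ⁻¹ * ((∫ s in (0:ℝ)..δ, F t (u + s)) - δ * F t u) := by
      simp only [hH]
      field_simp
    rw [h2, abs_mul, abs_of_pos (inv_pos.2 hδ), inv_mul_le_iff₀ hδ]
    linarith
  have hLip : ∀ t ∈ Icc 0 T, LipschitzWith (Real.toNNReal (δ⁻¹ * (2 * C))) (H t) := by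
    intro t ht
    refine LipschitzWith.of_dist_le_mul fun u w => ?_
    have hi : ∀ a b, IntervalIntegrable (F t) volume a b := fun a b => (hFt t).intervalIntegrable a b
    have hb : ∀ a b, |∫ s in a..b, F t s| ≤ C * |b - a| := fun a b => by
      rw [← Real.norm_eq_abs]
      exact intervalIntegral.norm_integral_le_of_norm_le_const fun s _ => hC t ht _
    have h1 : H t u - H t w = δ⁻¹ * ((∫ s in (w + δ)..(u + δ), F t s) - ∫ s in w..u, F t s) := by
      have h3 := intervalIntegral.integral_interval_sub_interval_comm (hi u (u + δ)) (hi w (w + δ))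
        (hi u w)
      simp only [hH, intervalIntegral.integral_comp_add_left, add_zero]
      rw [← mul_sub, h3, intervalIntegral.integral_symm u w,
        intervalIntegral.integral_symm (u + δ) (w + δ)]
      ring
    rw [Real.coe_toNNReal _ (by positivity), Real.dist_eq, Real.dist_eq, h1, abs_mul,
      abs_of_pos (inv_pos.2 hδ), mul_assoc]
    refine mul_le_mul_of_nonneg_left ?_ (inv_pos.2 hδ).le
    have h4 := hb (w + δ) (u + δ)
    rw [add_sub_add_right_eq_sub] at h4
    linarith [abs_sub (∫ s in (w + δ)..(u + δ), F t s) (∫ s in w..u, F t s), hb w u]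
  have hPL : IsPicardLindelof H (⟨0, left_mem_Icc.2 hT⟩ : Icc 0 T) x (Real.toNNReal (C * T)) 0
      (Real.toNNReal C) (Real.toNNReal (δ⁻¹ * (2 * C))) := by
    refine ⟨fun t ht => (hLip t ht).lipschitzOnWith, fun u _ => ?_, fun t ht u _ => ?_, ?_⟩
    · exact (hHcont.comp (by fun_prop : Continuous fun t => (t, u))).continuousOn
    · rw [Real.coe_toNNReal _ hC0]
      exact hHC t ht u
    · rw [Real.coe_toNNReal _ hC0, Real.coe_toNNReal _ (mul_nonneg hC0 hT)]
      simp [hT]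
  obtain ⟨φ, hφ0, hφ⟩ := hPL.exists_eq_forall_mem_Icc_hasDerivWithinAt₀
  have hφc : ContinuousOn φ (Icc 0 T) := fun t ht => (hφ t ht).continuousWithinAt
  have hpc : ContinuousOn (fun t => H t (φ t)) (Icc 0 T) :=
    hHcont.comp_continuousOn (continuousOn_id.prodMk hφc)
  refine ⟨φ, fun t => H t (φ t), ⟨hφc, fun a ha b hb hab => ?_⟩, hφ0, fun t ht => hHF t ht _⟩
  have hsub : Icc a b ⊆ Icc 0 T := Icc_subset_Icc ha.1 hb.2
  have hi : IntervalIntegrable (fun t => H t (φ t)) volume a b :=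
    (hpc.mono hsub).intervalIntegrable_of_Icc hab
  refine ⟨hi, (intervalIntegral.integral_eq_sub_of_hasDerivAt_of_le hab (hφc.mono hsub)
    (fun t ht => ?_) hi).symm⟩
  exact (hφ t (hsub (Ioo_subset_Icc_self ht))).hasDerivAt
    (Icc_mem_nhds (ha.1.trans_lt ht.1) (ht.2.trans_le hb.2))

/-- Existence for the Cauchy problem whose vector field is decreasing in space. -/
theorem exists_isPrimitiveOn_of_antitone {F : ℝ → ℝ → ℝ} {T C : ℝ} (hT : 0 ≤ T)
    (hF : Continuous fun q : ℝ × ℝ => F q.1 q.2) (hC : ∀ t ∈ Icc 0 T, ∀ u, |F t u| ≤ C)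
    (hunif : ∀ ε > 0, ∃ δ > 0, ∀ t ∈ Icc 0 T, ∀ u w, |u - w| ≤ δ → |F t u - F t w| ≤ ε)
    (hanti : ∀ t, Antitone (F t)) (x : ℝ) :
    ∃ φ : ℝ → ℝ, IsPrimitiveOn φ (fun t => F t (φ t)) (Icc 0 T) ∧ φ 0 = x := by
  set e : ℕ → ℝ := fun n => 1 / ((n : ℝ) + 1) with he
  have he0 : ∀ n, 0 < e n := fun n => Nat.one_div_pos_of_nat
  have hlim : Tendsto e atTop (𝓝 0) := tendsto_one_div_add_atTop_nhds_zero_nat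
  choose φ p hφ hφ0 hp using fun n => exists_approximate_solution hT hF hC hunif x (he0 n)
  have hle : ∀ n m, ∀ t ∈ Icc 0 T, φ n t - φ m t ≤ (e n + e m) * T := by
    intro n m t ht
    have hsub : Icc 0 t ⊆ Icc 0 T := Icc_subset_Icc_right ht.2
    have h1 := ((hφ n).mono hsub).sub_le (c := 0) (ε := e n + e m) ht.1 ((hφ m).mono hsub)
      (by linarith [he0 n, he0 m]) (fun s hs hlt => by
        have h1 := (abs_le.1 (hp n s (hsub hs))).2
        have h2 := (abs_le.1 (hp m s (hsub hs))).1
        have h3 := hanti s (by linarith : φ m s ≤ φ n s)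
        linarith) (by simp [hφ0])
    nlinarith [ht.2, mul_le_mul_of_nonneg_left ht.2 (by linarith [he0 n, he0 m] : 0 ≤ e n + e m)]
  have hdist : ∀ n m, ∀ t ∈ Icc 0 T, |φ n t - φ m t| ≤ (e n + e m) * T := fun n m t ht =>
    abs_le.2 ⟨by linarith [hle m n t ht], hle n m t ht⟩
  have hex : ∀ t, ∃ y, t ∈ Icc 0 T → Tendsto (fun n => φ n t) atTop (𝓝 y) := by
    intro t
    by_cases ht : t ∈ Icc 0 T
    · have hc : CauchySeq fun n => φ n t := by
        refine cauchySeq_of_le_tendsto_0 (fun N => (e N + e N) * T) (fun n m N hn hm => ?_) ?_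
        · have h1 : e n ≤ e N := Nat.one_div_le_one_div hn
          have h2 : e m ≤ e N := Nat.one_div_le_one_div hm
          exact (hdist n m t ht).trans (by gcongr)
        · simpa using (hlim.add hlim).mul_const T
      obtain ⟨y, hy⟩ := cauchySeq_tendsto_of_complete hc
      exact ⟨y, fun _ => hy⟩
    · exact ⟨0, fun h => absurd h ht⟩
  choose ψ hψ using hex
  have hunifψ : TendstoUniformlyOn φ ψ atTop (Icc 0 T) := by
    rw [Metric.tendstoUniformlyOn_iff]
    intro ε hε
    have h0 : Tendsto (fun n => e n * T) atTop (𝓝 0) := by simpa using hlim.mul_const T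
    filter_upwards [h0.eventually_lt_const hε] with n hn t ht
    rw [dist_comm, Real.dist_eq]
    refine lt_of_le_of_lt ?_ hn
    refine le_of_tendsto_of_tendsto ((tendsto_const_nhds.sub (hψ t ht)).abs)
      (by simpa using (hlim.const_add (e n)).mul_const T)
      (Eventually.of_forall fun m => hdist n m t ht)
  have hψc : ContinuousOn ψ (Icc 0 T) :=
    hunifψ.continuousOn (Frequently.of_forall fun n => (hφ n).1)
  have hpc : ContinuousOn (fun t => F t (ψ t)) (Icc 0 T) :=
    hF.comp_continuousOn (continuousOn_id.prodMk hψc)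
  have h0T : (0 : ℝ) ∈ Icc 0 T := left_mem_Icc.2 hT
  refine ⟨ψ, ⟨hψc, fun a ha b hb hab => ?_⟩, ?_⟩
  · have hsub : Icc a b ⊆ Icc 0 T := Icc_subset_Icc ha.1 hb.2
    refine ⟨(hpc.mono hsub).intervalIntegrable_of_Icc hab, ?_⟩
    have hmem : ∀ s ∈ uIoc a b, s ∈ Icc 0 T := fun s hs => by
      rw [uIoc_of_le hab] at hs
      exact hsub (Ioc_subset_Icc_self hs)
    have h1 : Tendsto (fun n => ∫ s in a..b, p n s) atTop (𝓝 (∫ s in a..b, F s (ψ s))) := by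
      refine intervalIntegral.tendsto_integral_filter_of_dominated_convergence (fun _ => C + 1)
        (Eventually.of_forall fun n => by
          rw [uIoc_of_le hab]
          exact ((hφ n).2 a ha b hb hab).1.aestronglyMeasurable)
        (Eventually.of_forall fun n => Eventually.of_forall fun s hs => ?_)
        intervalIntegrable_const (Eventually.of_forall fun s hs => ?_)
      · have h2 := hp n s (hmem s hs)
        have h3 := hC s (hmem s hs) (φ n s)
        have h4 : e n ≤ 1 := by simpa [he] using Nat.one_div_le_one_div (α := ℝ) (Nat.zero_le n)
        rw [Real.norm_eq_abs]
        linarith [abs_sub_abs_le_abs_sub (p n s) (F s (φ n s))]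
      · have hFs : Continuous (F s) := hF.comp (by fun_prop : Continuous fun u => (s, u))
        have h2 := (hFs.tendsto (ψ s)).comp (hψ s (hmem s hs))
        have h3 : Tendsto (fun n => p n s - F s (φ n s)) atTop (𝓝 0) :=
          squeeze_zero_norm (fun n => hp n s (hmem s hs)) hlim
        simpa using h3.add h2
    refine tendsto_nhds_unique ((hψ b hb).sub (hψ a ha)) (h1.congr fun n => ?_)
    exact ((hφ n).2 a ha b hb hab).2.symm
  · exact tendsto_nhds_unique (hψ 0 h0T) (by simp [hφ0])

/-- A continuous periodic vector field that is decreasing in space and has zeros is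
nonpositive above some level. -/
theorem exists_forall_nonpos_of_antitone {G : ℝ → ℝ → ℝ} {T : ℝ} (hT : 0 < T)
    (hcont : Continuous fun q : ℝ × ℝ => G q.1 q.2)
    (hperG : ∀ u, Function.Periodic (fun t => G t u) T) (hmono : ∀ t, Antitone (G t))
    (hzero : ∀ t, ∃! u : ℝ, G t u = 0) : ∃ m, ∀ t, ∀ u, m ≤ u → G t u ≤ 0 := by
  have key : ∃ m, ∀ t ∈ Icc 0 T, G t m ≤ 0 := by
    refine isCompact_Icc.induction_on (p := fun s => ∃ m, ∀ t ∈ s, G t m ≤ 0) ⟨0, by simp⟩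
      (fun s t hst ⟨m, hm⟩ => ⟨m, fun x hx => hm x (hst hx)⟩) ?_ ?_
    · rintro s t ⟨m, hm⟩ ⟨n, hn⟩
      refine ⟨max m n, fun x hx => ?_⟩
      rcases hx with hx | hx
      · exact (hmono x (le_max_left m n)).trans (hm x hx)
      · exact (hmono x (le_max_right m n)).trans (hn x hx)
    · intro t _
      obtain ⟨u, hu, huniq⟩ := hzero t
      have hlt : G t (u + 1) < 0 := by
        refine lt_of_le_of_ne ((hmono t (by linarith : u ≤ u + 1)).trans_eq hu) fun h => ?_
        linarith [huniq _ h]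
      have hc : Continuous fun s => G s (u + 1) :=
        hcont.comp (by fun_prop : Continuous fun s : ℝ => (s, u + 1))
      refine ⟨{s | G s (u + 1) < 0}, mem_nhdsWithin_of_mem_nhds ?_, u + 1, fun s hs => le_of_lt hs⟩
      exact (isOpen_lt hc continuous_const).mem_nhds hlt
  obtain ⟨m, hm⟩ := key
  refine ⟨m, fun t u hu => (hmono t hu).trans ?_⟩
  obtain ⟨s, hs, hst⟩ := (hperG m).exists_mem_Ico₀ hT t
  exact hst.trans_le (hm s (Ico_subset_Icc_self hs))

theorem continuous_reflect {G : ℝ → ℝ → ℝ} (hcont : Continuous fun q : ℝ × ℝ => G q.1 q.2) :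
    Continuous fun q : ℝ × ℝ => -G q.1 (-q.2) :=
  (hcont.comp (by fun_prop : Continuous fun q : ℝ × ℝ => (q.1, -q.2))).neg

theorem antitone_reflect {g : ℝ → ℝ} (hg : Antitone g) : Antitone fun u => -g (-u) :=
  fun _ _ h => neg_le_neg (hg (neg_le_neg h))

theorem existsUnique_zero_reflect {g : ℝ → ℝ} (hg : ∃! u, g u = 0) : ∃! u, -g (-u) = 0 := by
  obtain ⟨u, hu, huniq⟩ := hg
  refine ⟨-u, by simpa using hu, fun y hy => ?_⟩
  rw [← huniq (-y) (neg_eq_zero.1 hy), neg_neg]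

/-- A solution is eventually at most slightly above any periodic solution. -/
theorem eventually_sub_le_of_antitone {G : ℝ → ℝ → ℝ} {T : ℝ} (hT : 0 < T)
    (hcont : Continuous fun q : ℝ × ℝ => G q.1 q.2)
    (hperG : ∀ u, Function.Periodic (fun t => G t u) T) (hmono : ∀ t, Antitone (G t))
    (hzero : ∀ t, ∃! u : ℝ, G t u = 0) {v w : ℝ → ℝ} {t₀ : ℝ}
    (hv : IsPrimitiveOn v (fun t => G t (v t)) (Ici t₀))
    (hw : ∀ t, HasDerivAt w (G t (w t)) t) (hwper : Function.Periodic w T) {c : ℝ} (hc : 0 < c) :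
    ∀ᶠ t in atTop, v t - w t ≤ c := by
  have hwc : Continuous w := continuous_iff_continuousAt.2 fun t => (hw t).continuousAt
  have hGw : Continuous fun t => G t (w t) :=
    hcont.comp (by fun_prop : Continuous fun t => (t, w t))
  have hGwc : Continuous fun t => G t (w t + c) :=
    hcont.comp (by fun_prop : Continuous fun t => (t, w t + c))
  have hwp := IsPrimitiveOn.of_hasDerivAt hw hGw (Ici t₀)
  suffices h : ∃ t₁, t₀ ≤ t₁ ∧ v t₁ - w t₁ ≤ c by
    obtain ⟨t₁, ht₁, hle⟩ := h
    filter_upwards [eventually_ge_atTop t₁] with t ht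
    have hsub : Icc t₁ t ⊆ Ici t₀ := fun s hs => ht₁.trans hs.1
    simpa using (hv.mono hsub).sub_le ht (hwp.mono hsub) le_rfl
      (fun s _ hs => by simpa using hmono s (by linarith : w s ≤ v s)) hle
  by_contra! hcon
  have hκ : 0 < ∫ s in (0 : ℝ)..T, (G s (w s) - G s (w s + c)) := by
    refine intervalIntegral.integral_pos hT (hGw.sub hGwc).continuousOn
      (fun s _ => sub_nonneg.2 (hmono s (by linarith))) ?_
    obtain ⟨s, hs, hs0⟩ := exists_hasDerivAt_eq_zero hT hwc.continuousOn
      (by simpa using (hwper 0).symm) (fun s _ => hw s)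
    refine ⟨s, Ioo_subset_Icc_self hs, sub_pos.2 (lt_of_le_of_ne (hmono s (by linarith)) ?_)⟩
    intro heq
    linarith [(hzero s).unique (heq.trans hs0) hs0]
  set κ := ∫ s in (0 : ℝ)..T, (G s (w s) - G s (w s + c)) with hκdef
  have hper : Function.Periodic (fun s => G s (w s) - G s (w s + c)) T := fun s => by
    have h1 := hperG (w s) s
    have h2 := hperG (w s + c) s
    simp only at h1 h2
    simp only [hwper s, h1, h2]
  have hstep : ∀ t, t₀ ≤ t → v (t + T) - w (t + T) ≤ v t - w t - κ := by
    intro t ht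
    have htT : t ≤ t + T := by linarith
    obtain ⟨hvi, hve⟩ := hv.2 t ht (t + T) (ht.trans htT) htT
    obtain ⟨-, hwe⟩ := hwp.2 t ht (t + T) (ht.trans htT) htT
    have hle : ∫ s in t..(t + T), G s (v s) ≤ ∫ s in t..(t + T), G s (w s + c) :=
      intervalIntegral.integral_mono_on htT hvi (hGwc.intervalIntegrable _ _) fun s hs =>
        hmono s (by linarith [hcon s (ht.trans hs.1)])
    have heq := hper.intervalIntegral_add_eq t 0
    rw [zero_add, ← hκdef, intervalIntegral.integral_sub (hGw.intervalIntegrable _ _)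
      (hGwc.intervalIntegrable _ _)] at heq
    linarith
  have hiter : ∀ n : ℕ, v (t₀ + n * T) - w (t₀ + n * T) ≤ v t₀ - w t₀ - n * κ := by
    intro n
    induction n with
    | zero => simp
    | succ n ih =>
      have h1 := hstep (t₀ + n * T) (le_add_of_nonneg_right (by positivity))
      push_cast
      rw [show t₀ + ((n : ℝ) + 1) * T = t₀ + n * T + T by ring]
      linarith
  obtain ⟨n, hn⟩ := exists_nat_gt ((v t₀ - w t₀) / κ)
  rw [div_lt_iff₀ hκ] at hn
  linarith [hiter n, hcon (t₀ + n * T) (le_add_of_nonneg_right (by positivity))]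

theorem tendsto_sub_of_antitone {G : ℝ → ℝ → ℝ} {T : ℝ} (hT : 0 < T)
    (hcont : Continuous fun q : ℝ × ℝ => G q.1 q.2)
    (hperG : ∀ u, Function.Periodic (fun t => G t u) T) (hmono : ∀ t, Antitone (G t))
    (hzero : ∀ t, ∃! u : ℝ, G t u = 0) {v w : ℝ → ℝ} {t₀ : ℝ}
    (hv : IsPrimitiveOn v (fun t => G t (v t)) (Ici t₀))
    (hw : ∀ t, HasDerivAt w (G t (w t)) t) (hwper : Function.Periodic w T) :
    Tendsto (fun t => v t - w t) atTop (𝓝 0) := by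
  rw [Metric.tendsto_nhds]
  intro ε hε
  have h1 := eventually_sub_le_of_antitone hT hcont hperG hmono hzero hv hw hwper (half_pos hε)
  have h2 := eventually_sub_le_of_antitone (G := fun t u => -G t (-u)) (v := fun t => -v t)
    (w := fun t => -w t) (t₀ := t₀) hT (continuous_reflect hcont)
    (fun u t => congrArg Neg.neg (hperG (-u) t))
    (fun t => antitone_reflect (hmono t)) (fun t => existsUnique_zero_reflect (hzero t))
    (by simpa using hv.neg) (fun t => by rw [neg_neg]; exact (hw t).neg)
    (fun t => congrArg Neg.neg (hwper t)) (half_pos hε)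
  filter_upwards [h1, h2] with t ht1 ht2
  rw [dist_zero_right, Real.norm_eq_abs]
  exact (abs_le.2 ⟨by linarith, ht1⟩ : |v t - w t| ≤ ε / 2).trans_lt (half_lt_self hε)

/-- Solvability of the Cauchy problem in an interval at whose ends the field points inwards. -/
theorem exists_isPrimitiveOn_mem_Icc {G : ℝ → ℝ → ℝ} {T m M : ℝ} (hT : 0 ≤ T) (hmM : m ≤ M)
    (hcont : Continuous fun q : ℝ × ℝ => G q.1 q.2) (hmono : ∀ t, Antitone (G t))
    (hm : ∀ t, 0 ≤ G t m) (hM : ∀ t, G t M ≤ 0) {x : ℝ} (hx : x ∈ Icc m M) :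
    ∃ φ : ℝ → ℝ, IsPrimitiveOn φ (fun t => G t (φ t)) (Icc 0 T) ∧ φ 0 = x ∧ φ T ∈ Icc m M := by
  set k : ℝ → ℝ := fun u => max m (min u M) with hk
  have hkmem : ∀ u, k u ∈ Icc m M := fun u => ⟨le_max_left _ _, max_le hmM (min_le_right _ _)⟩
  have hkdist : ∀ u w, |k u - k w| ≤ |u - w| := fun u w =>
    calc |k u - k w| ≤ max |m - m| |min u M - min w M| := abs_max_sub_max_le_max _ _ _ _
      _ ≤ max |m - m| (max |u - w| |M - M|) := max_le_max le_rfl (abs_min_sub_min_le_max _ _ _ _)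
      _ = |u - w| := by simp
  have hkid : ∀ u ∈ Icc m M, k u = u := fun u hu => by
    simp only [hk, min_eq_left hu.2, max_eq_right hu.1]
  have hkc : Continuous k := by fun_prop
  have hK : IsCompact (Icc 0 T ×ˢ Icc m M) := isCompact_Icc.prod isCompact_Icc
  obtain ⟨C, hC⟩ := hK.exists_bound_of_continuousOn hcont.continuousOn
  have hunif := hK.uniformContinuousOn_of_continuous hcont.continuousOn
  rw [Metric.uniformContinuousOn_iff] at hunif
  obtain ⟨φ, hφ, hφ0⟩ := exists_isPrimitiveOn_of_antitone (F := fun t u => G t (k u)) (C := C) hT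
    (hcont.comp (by fun_prop : Continuous fun q : ℝ × ℝ => (q.1, k q.2)))
    (fun t ht u => hC (t, k u) ⟨ht, hkmem u⟩)
    (fun ε hε => by
      obtain ⟨δ, hδ, h⟩ := hunif ε hε
      refine ⟨δ / 2, half_pos hδ, fun t ht u w huw => ?_⟩
      refine (h (t, k u) ⟨ht, hkmem u⟩ (t, k w) ⟨ht, hkmem w⟩ ?_).le
      rw [Prod.dist_eq, dist_self, max_eq_right dist_nonneg, Real.dist_eq]
      linarith [hkdist u w])
    (fun t u w huw => hmono t (max_le_max le_rfl (min_le_min huw le_rfl))) x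
  have hmem : ∀ t ∈ Icc 0 T, φ t ∈ Icc m M := by
    intro t ht
    have hφt := hφ.mono (Icc_subset_Icc_right ht.2 : Icc 0 t ⊆ Icc 0 T)
    constructor
    · have := (IsPrimitiveOn.const m _).sub_le (c := 0) ht.1 hφt le_rfl (fun s _ hs => by
        have : k (φ s) = m :=
          max_eq_left ((min_le_left _ _).trans (by linarith))
        simpa [this] using hm s) (by rw [hφ0]; linarith [hx.1])
      linarith
    · have := hφt.sub_le (c := 0) ht.1 (IsPrimitiveOn.const M _) le_rfl (fun s _ hs => by
        have : k (φ s) = M := by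
          simp only [hk]
          rw [min_eq_right (by linarith), max_eq_right hmM]
        simpa [this] using hM s) (by rw [hφ0]; linarith [hx.2])
      linarith
  refine ⟨φ, ⟨hφ.1, fun a ha b hb hab => ?_⟩, hφ0, hmem T (right_mem_Icc.2 hT)⟩
  obtain ⟨h1, h2⟩ := hφ.2 a ha b hb hab
  have heq : EqOn (fun s => G s (k (φ s))) (fun s => G s (φ s)) (uIcc a b) := fun s hs => by
    rw [uIcc_of_le hab] at hs
    simp only [hkid _ (hmem s ⟨ha.1.trans hs.1, hs.2.trans hb.2⟩)]
  exact ⟨h1.congr fun s hs => heq (uIoc_subset_uIcc hs),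
    h2.trans (intervalIntegral.integral_congr heq)⟩

/-- A solution on one period with equal end values extends to a periodic solution. -/
theorem exists_periodic_of_isPrimitiveOn {G : ℝ → ℝ → ℝ} {T : ℝ} (hT : 0 < T)
    (hcont : Continuous fun q : ℝ × ℝ => G q.1 q.2)
    (hperG : ∀ u, Function.Periodic (fun t => G t u) T) {φ : ℝ → ℝ}
    (hφ : IsPrimitiveOn φ (fun t => G t (φ t)) (Icc 0 T)) (hφT : φ T = φ 0) :
    ∃ w : ℝ → ℝ, (∀ t, HasDerivAt w (G t (w t)) t) ∧ Function.Periodic w T := by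
  have h0 : (0 : ℝ) ∈ Icc 0 T := left_mem_Icc.2 hT.le
  have hTm : T ∈ Icc 0 T := right_mem_Icc.2 hT.le
  set g : ℝ → ℝ := fun t => G (toIcoMod hT 0 t) (φ (toIcoMod hT 0 t)) with hg
  have hgper : Function.Periodic g T := fun t => by simp only [hg, toIcoMod_add_right]
  have hgeq : ∀ t ∈ Ico 0 T, g t = G t (φ t) := fun t ht => by
    have : toIcoMod hT 0 t = t := (toIcoMod_eq_self hT).2 (by simpa using ht)
    simp only [hg, this]
  have hae : ∀ b ∈ Icc 0 T, ∀ᵐ t ∂(volume : Measure ℝ), t ∈ uIoc 0 b → G t (φ t) = g t := by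
    intro b hb
    filter_upwards [compl_mem_ae_iff.2 (measure_singleton (μ := volume) T)] with t htT ht
    rw [uIoc_of_le hb.1] at ht
    exact (hgeq t ⟨ht.1.le, lt_of_le_of_ne (ht.2.trans hb.2) htT⟩).symm
  have hgi : ∀ a b, IntervalIntegrable g volume a b := by
    refine hgper.intervalIntegrable₀ hT.ne' ?_
    exact (hφ.2 0 h0 T hTm hT.le).1.congr_ae ((ae_restrict_iff' measurableSet_uIoc).2 (hae T hTm))
  set w : ℝ → ℝ := fun t => φ 0 + ∫ s in (0 : ℝ)..t, g s with hw
  have hwφ : ∀ t ∈ Icc 0 T, w t = φ t := fun t ht => by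
    have h1 := (hφ.2 0 h0 t ht ht.1).2
    rw [intervalIntegral.integral_congr_ae (hae t ht)] at h1
    simp only [hw]
    linarith
  have hgT : ∫ s in (0 : ℝ)..T, g s = 0 := by
    have := hwφ T hTm
    simp only [hw, hφT] at this
    linarith
  have hwper : Function.Periodic w T := fun t => by
    have h1 := hgper.intervalIntegral_add_eq t 0
    rw [zero_add, hgT] at h1
    simp only [hw]
    rw [← intervalIntegral.integral_add_adjacent_intervals (hgi 0 t) (hgi t (t + T)), h1, add_zero]
  have hwc : Continuous w :=
    continuous_const.add (intervalIntegral.continuous_primitive hgi 0)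
  have hgw : g = fun t => G t (w t) := by
    funext t
    have hmem : toIcoMod hT 0 t ∈ Ico 0 T := by simpa using toIcoMod_mem_Ico hT 0 t
    have h1 : w (toIcoMod hT 0 t) = w t := by
      rw [toIcoMod]
      exact hwper.sub_zsmul_eq _
    have h2 : G (toIcoMod hT 0 t) (w t) = G t (w t) := by
      rw [toIcoMod]
      exact (hperG (w t)).sub_zsmul_eq _
    simp only [hg]
    rw [← hwφ _ (Ico_subset_Icc_self hmem), h1, h2]
  have hgc : Continuous g := by
    rw [hgw]
    exact hcont.comp (by fun_prop : Continuous fun t => (t, w t))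
  refine ⟨w, fun t => ?_, hwper⟩
  rw [show G t (w t) = g t by rw [hgw]]
  exact ((hgc.integral_hasStrictDerivAt 0 t).hasDerivAt).const_add _

/-- The time `T` map of a vector field decreasing in space is nonexpansive, and a fixed point of it
gives a periodic solution. -/
theorem exists_periodic_of_antitone {G : ℝ → ℝ → ℝ} {T m M : ℝ} (hT : 0 < T) (hmM : m ≤ M)
    (hcont : Continuous fun q : ℝ × ℝ => G q.1 q.2)
    (hperG : ∀ u, Function.Periodic (fun t => G t u) T) (hmono : ∀ t, Antitone (G t))
    (hm : ∀ t, 0 ≤ G t m) (hM : ∀ t, G t M ≤ 0) :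
    ∃ w : ℝ → ℝ, (∀ t, HasDerivAt w (G t (w t)) t) ∧ Function.Periodic w T := by
  choose! φ hφ hφ0 hφT using fun (x : ℝ) (hx : x ∈ Icc m M) =>
    exists_isPrimitiveOn_mem_Icc hT.le hmM hcont hmono hm hM hx
  have hle : ∀ x ∈ Icc m M, ∀ y ∈ Icc m M, φ x T - φ y T ≤ |x - y| := by
    intro x hx y hy
    have := (hφ x hx).sub_le (c := |x - y|) hT.le (hφ y hy) le_rfl (fun s _ hs => by
      rw [add_zero]
      exact hmono s (by linarith [abs_nonneg (x - y)]))
      (by rw [hφ0 x hx, hφ0 y hy]; exact le_abs_self _)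
    linarith
  have hlip : LipschitzOnWith 1 (fun x => φ x T) (Icc m M) := by
    refine LipschitzOnWith.of_dist_le_mul fun x hx y hy => ?_
    rw [NNReal.coe_one, one_mul, Real.dist_eq, Real.dist_eq]
    have := hle y hy x hx
    rw [abs_sub_comm] at this
    exact abs_le.2 ⟨by linarith, hle x hx y hy⟩
  obtain ⟨x, hx, hfix⟩ := exists_mem_Icc_isFixedPt_of_mapsTo hlip.continuousOn hmM hφT
  exact exists_periodic_of_isPrimitiveOn hT hcont hperG (hφ x hx) (hfix.trans (hφ0 x hx).symm)

/-- Let `G : ℝ × ℝ → ℝ` be single-valued, continuous, `T`-periodic in `t`,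
monotone decreasing in `u`, satisfying the dissipativity assumption (S2), and such that for
every `t` there is a unique `u_t` with `G(t,u_t) = 0`. Then `v̇ = G(t,v)` admits exactly one
`T`-periodic solution `v*`, a global attractor for the dynamics. -/
theorem single_valued_monotone_unique_zero (T : ℝ) (hT : 0 < T) (G : ℝ → ℝ → ℝ)
    (hcont : Continuous fun q : ℝ × ℝ => G q.1 q.2)
    (hperG : ∀ u, Function.Periodic (fun t => G t u) T)
    (hmono : ∀ t, Antitone (G t))
    (R : ℝ) (hR : 0 < R) (ℓm ℓp : ℝ → ℝ)
    (hℓm_meas : Measurable ℓm) (hℓp_meas : Measurable ℓp)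
    (hℓm_per : Function.Periodic ℓm T) (hℓp_per : Function.Periodic ℓp T)
    (hℓm_int : (∫ s in (0:ℝ)..T, ℓm s) < 0) (hℓp_int : (∫ s in (0:ℝ)..T, ℓp s) < 0)
    (hbdm : ∀ᵐ t ∂(volume : Measure ℝ), ∀ u ≤ -R, -ℓm t ≤ G t u)
    (hbdp : ∀ᵐ t ∂(volume : Measure ℝ), ∀ u, R ≤ u → G t u ≤ ℓp t)
    (hzero : ∀ t, ∃! u : ℝ, G t u = 0) :
    ∃ vstar : ℝ → ℝ,
      (IsSolOn (fun t u => {G t u}) vstar Set.univ ∧ Function.Periodic vstar T) ∧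
      (∀ u : ℝ → ℝ, IsSolOn (fun t u => {G t u}) u Set.univ → Function.Periodic u T →
        u = vstar) ∧
      ∀ (t₀ : ℝ) (v : ℝ → ℝ), IsSolOn (fun t u => {G t u}) v (Set.Ici t₀) →
        Tendsto (fun t => v t - vstar t) atTop (𝓝 0) := by
  obtain ⟨M, hM⟩ := exists_forall_nonpos_of_antitone hT hcont hperG hmono hzero
  obtain ⟨N, hN⟩ := exists_forall_nonpos_of_antitone (G := fun t u => -G t (-u)) hT
    (continuous_reflect hcont) (fun u t => congrArg Neg.neg (hperG (-u) t))
    (fun t => antitone_reflect (hmono t)) (fun t => existsUnique_zero_reflect (hzero t))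
  obtain ⟨w, hw, hwper⟩ := exists_periodic_of_antitone (m := -max N 0) (M := max M 0) hT
    (by linarith [le_max_right N 0, le_max_right M 0]) hcont hperG hmono
    (fun t => by simpa using hN t (max N 0) (le_max_left _ _))
    (fun t => hM t _ (le_max_left _ _))
  have hwc : Continuous w := continuous_iff_continuousAt.2 fun t => (hw t).continuousAt
  have hwp := IsPrimitiveOn.of_hasDerivAt hw
    (hcont.comp (by fun_prop : Continuous fun t => (t, w t))) univ
  have hattr : ∀ (t₀ : ℝ) (v : ℝ → ℝ), IsSolOn (fun t u => {G t u}) v (Ici t₀) →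
      Tendsto (fun t => v t - w t) atTop (𝓝 0) := fun t₀ v hv =>
    tendsto_sub_of_antitone hT hcont hperG hmono hzero (hv.isPrimitiveOn) hw hwper
  refine ⟨w, ⟨⟨fun t => G t (w t), hwp.2, by simp⟩, hwper⟩, fun u hu huper => ?_, hattr⟩
  obtain ⟨g, hg, hgG⟩ := hu
  have hlim := hattr 0 u ⟨g, fun a _ b _ => hg a trivial b trivial,
    hgG.mono fun t ht _ => ht trivial⟩
  funext t
  have hseq : Tendsto (fun n : ℕ => t + n * T) atTop atTop :=
    tendsto_atTop_add_const_left _ _ (tendsto_natCast_atTop_atTop.atTop_mul_const hT)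
  have hconst : ∀ n : ℕ, u (t + n * T) - w (t + n * T) = u t - w t := fun n => by
    rw [huper.nat_mul n t, hwper.nat_mul n t]
  exact sub_eq_zero.1 (tendsto_nhds_unique
    (tendsto_const_nhds.congr fun n => (hconst n).symm) (hlim.comp hseq))
end

section
/- Let α₁, …, α_n : ℝ → ℝ be continuous T-periodic functions with ∫₀ᵀ α_i(t) dt = 0 for every i. For each j ∈ {1, …, n}, let Γ_j(t) denote the j-th smallest value (counting multiplicity) among α₁(t), …, α_n(t). Then each Γ_j is continuous and T-periodic, and for every δ > 0 and every index j ∈ {1, …, n−1} the set {t ∈ [0,T) : Γ_{j+1}(t) − Γ_j(t) < δ} has positive Lebesgue measure. -/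
open MeasureTheory Set Filter Topology
open scoped Classical

/-- Two predicates on `Fin n` which together hold more than `n` times hold simultaneously
somewhere. -/
theorem exists_and_of_lt_card_filter_add_card_filter {n : ℕ} {p q : Fin n → Prop}
    [DecidablePred p] [DecidablePred q]
    (h : n < (Finset.univ.filter p).card + (Finset.univ.filter q).card) :
    ∃ i, p i ∧ q i := by
  by_contra! hne
  have hdisj : Disjoint (Finset.univ.filter p) (Finset.univ.filter q) :=
    Finset.disjoint_filter.2 fun i _ hp => hne i hp
  have hle := Finset.card_le_univ (Finset.univ.filter p ∪ Finset.univ.filter q)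
  rw [Finset.card_union_of_disjoint hdisj, Fintype.card_fin] at hle
  omega

/-- Two incompatible predicates on `Fin n` which together hold at least `n` times cover `Fin n`. -/
theorem or_of_le_card_filter_add_card_filter {n : ℕ} {p q : Fin n → Prop}
    [DecidablePred p] [DecidablePred q] (hpq : ∀ i, p i → ¬ q i)
    (h : n ≤ (Finset.univ.filter p).card + (Finset.univ.filter q).card) (i : Fin n) :
    p i ∨ q i := by
  have hdisj : Disjoint (Finset.univ.filter p) (Finset.univ.filter q) :=
    Finset.disjoint_filter.2 fun i _ => hpq i
  have huniv : Finset.univ.filter p ∪ Finset.univ.filter q = Finset.univ := by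
    refine Finset.eq_univ_of_card _ (le_antisymm (Finset.card_le_univ _) ?_)
    rwa [Finset.card_union_of_disjoint hdisj, Fintype.card_fin]
  simpa using huniv.ge (Finset.mem_univ i)

/-- Order statistics are `1`-Lipschitz for the sup distance: if `b ≤ a + ε` entrywise, the
`(j+1)`-th smallest value `y` of `b` is at most `x + ε`, with `x` that of `a`. -/
theorem orderStatistic_le_add {n : ℕ} {j : Fin n} {a b : Fin n → ℝ} {x y ε : ℝ}
    (hx : (j : ℕ) + 1 ≤ (Finset.univ.filter fun i => a i ≤ x).card)
    (hy : n - (j : ℕ) ≤ (Finset.univ.filter fun i => y ≤ b i).card)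
    (hab : ∀ i, b i ≤ a i + ε) : y ≤ x + ε := by
  have hj := j.2
  obtain ⟨i, hi, hi'⟩ := exists_and_of_lt_card_filter_add_card_filter
    (p := fun i => a i ≤ x) (q := fun i => y ≤ b i) (by omega)
  linarith [hab i]

/-- Let `α₁,…,α_n` be continuous `T`-periodic functions with zero mean over
a period, and for `j ∈ {0,…,n-1}` let `Γ j t` be the `(j+1)`-th smallest value (counting
multiplicity) among `α₁(t),…,α_n(t)`, characterized by: `Γ j t ≥ α i t` for at least `j+1`
indices and `Γ j t ≤ α i t` for at least `n - j` indices. Then each `Γ j` is continuous and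
`T`-periodic, and for every `δ > 0` and every non-top index `j`, the set
`{t ∈ [0,T) : Γ (j+1) t - Γ j t < δ}` has positive Lebesgue measure. -/
theorem ordered_values_lemma (T : ℝ) (hT : 0 < T) (n : ℕ)
    (α : Fin n → ℝ → ℝ)
    (hcont : ∀ i, Continuous (α i))
    (hper : ∀ i, Function.Periodic (α i) T)
    (hint : ∀ i, (∫ t in (0:ℝ)..T, α i t) = 0)
    (Γ : Fin n → ℝ → ℝ)
    (hΓge : ∀ (j : Fin n) (t : ℝ),
      (j : ℕ) + 1 ≤ (Finset.univ.filter fun i : Fin n => α i t ≤ Γ j t).card)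
    (hΓle : ∀ (j : Fin n) (t : ℝ),
      n - (j : ℕ) ≤ (Finset.univ.filter fun i : Fin n => Γ j t ≤ α i t).card) :
    (∀ j : Fin n, Continuous (Γ j) ∧ Function.Periodic (Γ j) T) ∧
    ∀ δ : ℝ, 0 < δ → ∀ (j : Fin n) (hj : (j : ℕ) + 1 < n),
      0 < volume {t : ℝ | t ∈ Set.Ico (0:ℝ) T ∧ Γ ⟨(j : ℕ) + 1, hj⟩ t - Γ j t < δ} := by
  have hlip : ∀ (j : Fin n) (s t ε : ℝ), (∀ i, α i t ≤ α i s + ε) → Γ j t ≤ Γ j s + ε :=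
    fun j s t ε h => orderStatistic_le_add (a := fun i => α i s) (b := fun i => α i t)
      (hΓge j s) (hΓle j t) h
  have hΓcont : ∀ j, Continuous (Γ j) := by
    intro j
    rw [continuous_iff_continuousAt]
    intro s
    rw [ContinuousAt, Metric.tendsto_nhds]
    intro ε hε
    have hev : ∀ᶠ t in 𝓝 s, ∀ i, dist (α i t) (α i s) < ε / 2 :=
      eventually_all.2 fun i =>
        Metric.tendsto_nhds.1 (hcont i).continuousAt _ (half_pos hε)
    filter_upwards [hev] with t ht
    simp only [Real.dist_eq, abs_lt] at ht ⊢
    have h₁ := hlip j s t (ε / 2) fun i => by linarith [(ht i).2]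
    have h₂ := hlip j t s (ε / 2) fun i => by linarith [(ht i).1]
    constructor <;> linarith
  have hΓper : ∀ j, Function.Periodic (Γ j) T := by
    intro j t
    have h₁ := hlip j t (t + T) 0 fun i => by simp [hper i t]
    have h₂ := hlip j (t + T) t 0 fun i => by simp [hper i t]
    linarith
  refine ⟨fun j => ⟨hΓcont j, hΓper j⟩, fun δ hδ j hj => ?_⟩
  set k : Fin n := ⟨(j : ℕ) + 1, hj⟩ with hk
  suffices hne : ∃ t ∈ Ioo 0 T, Γ k t - Γ j t < δ by
    have hopen : IsOpen (Ioo 0 T ∩ {t | Γ k t - Γ j t < δ}) :=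
      isOpen_Ioo.inter (isOpen_lt ((hΓcont k).sub (hΓcont j)) continuous_const)
    exact (hopen.measure_pos volume hne).trans_le
      (measure_mono fun t ht => ⟨Ioo_subset_Ico_self ht.1, ht.2⟩)
  by_contra! hgap
  have hmid : T / 2 ∈ Ioo 0 T := ⟨by linarith, by linarith⟩
  have hcover : ∀ t ∈ Ioo 0 T, ∀ i, α i t ≤ Γ j t ∨ Γ k t ≤ α i t := by
    intro t ht
    have hg := hgap t ht
    refine or_of_le_card_filter_add_card_filter (fun i h h' => by linarith) ?_
    have h₁ := hΓge j t
    have h₂ := hΓle k t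
    simp only [hk] at h₁ h₂ ⊢
    omega
  have havoid : ∀ i, ∀ t ∈ Ioo 0 T, α i t ≠ (Γ j t + Γ k t) / 2 := by
    intro i t ht h
    have hg := hgap t ht
    rcases hcover t ht i with h' | h' <;> linarith
  have hmcont : Continuous fun t => (Γ j t + Γ k t) / 2 :=
    ((hΓcont j).add (hΓcont k)).div_const 2
  obtain ⟨l, hl⟩ : ∃ l, α l (T / 2) ≤ Γ j (T / 2) := by
    have := Finset.card_pos.1 ((Nat.succ_pos _).trans_le (hΓge j (T / 2)))
    obtain ⟨l, hl⟩ := this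
    exact ⟨l, (Finset.mem_filter.1 hl).2⟩
  obtain ⟨u, hu⟩ : ∃ u, Γ k (T / 2) ≤ α u (T / 2) := by
    have := Finset.card_pos.1 ((Nat.sub_pos_of_lt k.2).trans_le (hΓle k (T / 2)))
    obtain ⟨u, hu⟩ := this
    exact ⟨u, (Finset.mem_filter.1 hu).2⟩
  have hgmid := hgap _ hmid
  have hlow : ∀ t ∈ Ioo 0 T, α l t < (Γ j t + Γ k t) / 2 := by
    intro t ht
    by_contra! h
    obtain ⟨x, hx, hx'⟩ := isPreconnected_Ioo.intermediate_value₂ hmid ht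
      (hcont l).continuousOn hmcont.continuousOn (by linarith) h
    exact havoid l x hx hx'
  have hupp : ∀ t ∈ Ioo 0 T, (Γ j t + Γ k t) / 2 < α u t := by
    intro t ht
    by_contra! h
    obtain ⟨x, hx, hx'⟩ := isPreconnected_Ioo.intermediate_value₂ ht hmid
      (hcont u).continuousOn hmcont.continuousOn h (by linarith)
    exact havoid u x hx hx'
  have hpos : 0 < ∫ t in (0 : ℝ)..T, (α u t - α l t) :=
    intervalIntegral.intervalIntegral_pos_of_pos_on
      (((hcont u).sub (hcont l)).intervalIntegrable 0 T)
      (fun t ht => by linarith [hlow t ht, hupp t ht]) hT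
  rw [intervalIntegral.integral_sub ((hcont u).intervalIntegrable 0 T)
    ((hcont l).intervalIntegrable 0 T), hint u, hint l] at hpos
  simp at hpos
end
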